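/- arXiv:2108.11290 — 3 statements merged into one kernel-verified Lean document; each statement's English description precedes it below -/
import Mathlib

section
/- For every integer n ≥ 2 there exists a topological multigraph G on n vertices (placed at the points 1, 2, …, n of the x-axis) with exactly Σ_{1 ≤ i < j ≤ n} (j − i) = (n³ − n)/6 edges, such that any two distinct edges share at most two common interior points, no two parallel edges cross, and every lens of G contains at least one vertex of G. In particular, there exist separated topological multigraphs in which any two edges cross at most twice having Ω(n³) edges. -/
open Set

/-- A topological multigraph: a finite vertex set `V ⊂ ℝ²` together with a finite family of
edges, each represented by a continuous injective arc `[0,1] → ℝ²` whose endpoints are two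
distinct vertices and whose interior avoids all vertices. -/
structure TopMultigraph where
  V : Finset (ℝ × ℝ)
  ι : Type
  fintype_ι : Fintype ι
  arc : ι → unitInterval → ℝ × ℝ
  continuous_arc : ∀ e, Continuous (arc e)
  injective_arc : ∀ e, Function.Injective (arc e)
  source_mem : ∀ e, arc e 0 ∈ V
  target_mem : ∀ e, arc e 1 ∈ V
  ends_ne : ∀ e, arc e 0 ≠ arc e 1
  interior_avoids : ∀ e (t : unitInterval), t ≠ 0 → t ≠ 1 → arc e t ∉ V

namespace TopMultigraph

variable (G : TopMultigraph)

instance : Fintype G.ι := G.fintype_ι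

/-- The number of edges of `G`. -/
noncomputable def edgeCount : ℕ := Nat.card G.ι

/-- The interior of an edge: the image of the open interval `(0,1)`. -/
def arcInterior (e : G.ι) : Set (ℝ × ℝ) :=
  G.arc e '' {t : unitInterval | t ≠ 0 ∧ t ≠ 1}

/-- The set of the two endpoints of an edge. -/
def endpoints (e : G.ι) : Set (ℝ × ℝ) := {G.arc e 0, G.arc e 1}

/-- Two distinct edges are parallel if they join the same pair of vertices. -/
def Parallel (e f : G.ι) : Prop := e ≠ f ∧ G.endpoints e = G.endpoints f

/-- Two edges are independent if they share no endpoint. -/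
def Independent (e f : G.ι) : Prop := Disjoint (G.endpoints e) (G.endpoints f)

/-- Two edges cross if their open arcs share a common point. -/
def Cross (e f : G.ι) : Prop := (G.arcInterior e ∩ G.arcInterior f).Nonempty

/-- `G` is single-crossing if any two distinct edges share at most one common interior point. -/
def SingleCrossing : Prop :=
  ∀ e f : G.ι, e ≠ f → (G.arcInterior e ∩ G.arcInterior f).Subsingleton

/-- An edge `e` joins `u` and `v` if its endpoint set is `{u, v}`. -/
def Joins (e : G.ι) (u v : ℝ × ℝ) : Prop := G.endpoints e = {u, v}

/-- The union of the images of all edges of `G` joining `u` and `v`. -/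
def pairUnion (u v : ℝ × ℝ) : Set (ℝ × ℝ) :=
  ⋃ e ∈ {e : G.ι | G.Joins e u v}, Set.range (G.arc e)

/-- `ℓ` is a lens of `G` at the pair `{u, v}`: `u ≠ v` are joined by at least one edge, no two
of the parallel edges joining them cross, and `ℓ` is a bounded connected component of the
complement of the union of the edges joining `u` and `v`. -/
def IsLensAt (u v : ℝ × ℝ) (ℓ : Set (ℝ × ℝ)) : Prop :=
  u ≠ v ∧ (∃ e, G.Joins e u v) ∧
  (∀ e f : G.ι, G.Joins e u v → G.Joins f u v → e ≠ f → ¬ G.Cross e f) ∧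
  Bornology.IsBounded ℓ ∧
  ∃ x ∈ (G.pairUnion u v)ᶜ, ℓ = connectedComponentIn (G.pairUnion u v)ᶜ x

/-- `ℓ` is a lens of `G`. -/
def IsLens (ℓ : Set (ℝ × ℝ)) : Prop := ∃ u v, G.IsLensAt u v ℓ

/-- `L(G)`: the set of all lenses of `G`. -/
def lenses : Set (Set (ℝ × ℝ)) := {ℓ | G.IsLens ℓ}

/-- No two parallel edges of `G` cross. -/
def ParallelNoncrossing : Prop := ∀ e f : G.ι, G.Parallel e f → ¬ G.Cross e f

/-- `G` is separated: no two parallel edges cross and every lens contains a vertex. -/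
def Separated : Prop :=
  G.ParallelNoncrossing ∧ ∀ ℓ, G.IsLens ℓ → ∃ v ∈ G.V, v ∈ ℓ

/-- The crossing number of `G`: the number of unordered pairs of distinct edges that cross. -/
noncomputable def crossingNumber : ℕ :=
  Nat.card {p : Sym2 G.ι // ¬ p.IsDiag ∧ ∀ e ∈ p, ∀ f ∈ p, e ≠ f → G.Cross e f}

/-- The degree of a vertex: the number of edges incident to it. -/
noncomputable def degree (v : ℝ × ℝ) : ℕ :=
  Nat.card {e : G.ι // v ∈ G.endpoints e}

end TopMultigraph

namespace DoubleCrossing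

/-- The curve: above the axis on `(i, c)`, below the axis on `(c, j)`. -/
noncomputable def ff (i j c x : ℝ) : ℝ := max (c - x) 0 * (x - i) + min (c - x) 0 * (j - x)

lemma ff_le {i j c x : ℝ} (h : x ≤ c) : ff i j c x = (c - x) * (x - i) := by
  unfold ff
  rw [max_eq_left (by linarith), min_eq_right (by linarith)]; ring

lemma ff_ge {i j c x : ℝ} (h : c ≤ x) : ff i j c x = (c - x) * (j - x) := by
  unfold ff
  rw [max_eq_right (by linarith), min_eq_left (by linarith)]; ring

lemma continuous_ff (i j c : ℝ) : Continuous (ff i j c) := by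
  unfold ff; fun_prop

lemma ff_pos {i j c x : ℝ} (hi : i < x) (h : x < c) : 0 < ff i j c x := by
  rw [ff_le h.le]; exact mul_pos (by linarith) (by linarith)

lemma ff_neg {i j c x : ℝ} (hj : x < j) (h : c < x) : ff i j c x < 0 := by
  rw [ff_ge h.le]; exact mul_neg_of_neg_of_pos (by linarith) (by linarith)

lemma lt_of_ff_pos {i j c x : ℝ} (hj : x < j) (h : 0 < ff i j c x) : x < c := by
  by_contra hc
  push Not at hc
  rw [ff_ge hc] at h
  nlinarith [mul_nonneg (sub_nonneg.2 hc) (sub_nonneg.2 hj.le)]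

lemma lt_of_ff_neg {i j c x : ℝ} (hi : i < x) (h : ff i j c x < 0) : c < x := by
  by_contra hc
  push Not at hc
  rw [ff_le hc] at h
  nlinarith [mul_nonneg (sub_nonneg.2 hc) (sub_nonneg.2 hi.le)]

lemma eq_of_ff_zero {i j c x : ℝ} (hi : i < x) (hj : x < j) (h : ff i j c x = 0) : x = c := by
  rcases lt_trichotomy x c with h1 | h1 | h1
  · have := ff_pos (j := j) hi h1; linarith
  · exact h1
  · have := ff_neg (i := i) hj h1; linarith

lemma ff_left {i j c : ℝ} (h : i ≤ c) : ff i j c i = 0 := by rw [ff_le h]; ring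

lemma ff_right {i j c : ℝ} (h : c ≤ j) : ff i j c j = 0 := by rw [ff_ge h]; ring

lemma ff_strictMono {i j c c' x : ℝ} (hi : i < x) (hj : x < j) (h : c < c') :
    ff i j c x < ff i j c' x := by
  rcases le_total x c with h1 | h1
  · rw [ff_le h1, ff_le (h1.trans h.le)]
    exact mul_lt_mul_of_pos_right (by linarith) (by linarith)
  · rcases lt_or_ge x c' with h2 | h2
    · have := ff_pos (j := j) hi h2
      refine lt_of_le_of_lt ?_ this
      rw [ff_ge h1]
      nlinarith [mul_nonneg (sub_nonneg.2 h1) (sub_nonneg.2 hj.le)]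
    · rw [ff_ge h1, ff_ge h2]
      exact mul_lt_mul_of_pos_right (by linarith) (by linarith)

lemma quad_unique {a b a' b' x y : ℝ} (hxy : x ≠ y) (hx : (a - x) * (x - b) = (a' - x) * (x - b'))
    (hy : (a - y) * (y - b) = (a' - y) * (y - b')) (h : b < a) (h' : b' < a') : a = a' := by
  have h1 : (a + b - a' - b') * (x - y) = 0 := by linear_combination hx - hy
  have h2 : a + b - a' - b' = 0 := (mul_eq_zero.1 h1).resolve_right (sub_ne_zero.2 hxy)
  have h3 : a * b = a' * b' := by linear_combination x * h2 - hx
  have h4 : (a - a') * (a - b') = 0 := by linear_combination a * h2 - h3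
  rcases mul_eq_zero.1 h4 with h5 | h5
  · linarith
  · linarith

lemma ff_pos_unique {i j c i' j' c' x y : ℝ} (hi : i < c) (hi' : i' < c')
    (hxj : x < j) (hxj' : x < j') (hyj : y < j) (hyj' : y < j')
    (hc : c ≠ c')
    (hx : ff i j c x = ff i' j' c' x) (hy : ff i j c y = ff i' j' c' y)
    (px : 0 < ff i j c x) (py : 0 < ff i j c y) : x = y := by
  by_contra hxy
  have a1 := lt_of_ff_pos hxj px
  have a2 := lt_of_ff_pos hyj py
  have a3 := lt_of_ff_pos hxj' (hx ▸ px)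
  have a4 := lt_of_ff_pos hyj' (hy ▸ py)
  rw [ff_le a1.le, ff_le a3.le] at hx
  rw [ff_le a2.le, ff_le a4.le] at hy
  exact hc (quad_unique hxy hx hy hi hi')

lemma ff_neg_unique {i j c i' j' c' x y : ℝ} (hi : c < j) (hi' : c' < j')
    (hxj : i < x) (hxj' : i' < x) (hyj : i < y) (hyj' : i' < y)
    (hc : c ≠ c')
    (hx : ff i j c x = ff i' j' c' x) (hy : ff i j c y = ff i' j' c' y)
    (px : ff i j c x < 0) (py : ff i j c y < 0) : x = y := by
  by_contra hxy
  have a1 := lt_of_ff_neg hxj px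
  have a2 := lt_of_ff_neg hyj py
  have a3 := lt_of_ff_neg hxj' (hx ▸ px)
  have a4 := lt_of_ff_neg hyj' (hy ▸ py)
  rw [ff_ge a1.le, ff_ge a3.le] at hx
  rw [ff_ge a2.le, ff_ge a4.le] at hy
  refine hc ?_
  have := quad_unique (a := -c) (b := -j) (a' := -c') (b' := -j') (x := -x) (y := -y)
    (fun h => hxy (neg_injective h)) (by linear_combination -hx) (by linear_combination -hy)
    (by linarith) (by linarith)
  linarith

/-- The index finset. -/
def pairs (n : ℕ) : Finset (ℕ × ℕ) :=
  (Finset.Icc 1 n ×ˢ Finset.Icc 1 n).filter (fun p => p.1 < p.2)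

lemma mem_pairs {n : ℕ} {p : ℕ × ℕ} :
    p ∈ pairs n ↔ 1 ≤ p.1 ∧ p.2 ≤ n ∧ p.1 < p.2 := by
  simp only [pairs, Finset.mem_filter, Finset.mem_product, Finset.mem_Icc]; omega

/-- The edge type. -/
abbrev Idx (n : ℕ) : Type := Σ p : {p // p ∈ pairs n}, Fin (p.1.2 - p.1.1)

variable {n : ℕ}

def li (e : Idx n) : ℕ := e.1.1.1
def ri (e : Idx n) : ℕ := e.1.1.2
def ki (e : Idx n) : ℕ := e.1.1.1 + e.2.1

lemma li_pos (e : Idx n) : 1 ≤ li e := (mem_pairs.1 e.1.2).1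
lemma ri_le (e : Idx n) : ri e ≤ n := (mem_pairs.1 e.1.2).2.1
lemma li_lt_ri (e : Idx n) : li e < ri e := (mem_pairs.1 e.1.2).2.2
lemma li_le_ki (e : Idx n) : li e ≤ ki e := Nat.le_add_right _ _
lemma ki_lt_ri (e : Idx n) : ki e < ri e := by
  have := e.2.2
  unfold ki ri; omega

lemma idx_ext {e f : Idx n} (h1 : li e = li f) (h2 : ri e = ri f) (h3 : ki e = ki f) : e = f := by
  obtain ⟨⟨⟨a, b⟩, h⟩, ⟨k, hk⟩⟩ := e
  obtain ⟨⟨⟨a', b'⟩, h'⟩, ⟨k', hk'⟩⟩ := f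
  simp only [li, ri, ki] at h1 h2 h3
  subst h1 h2
  have : k = k' := by omega
  subst this
  rfl

lemma idx_exists {i j k : ℕ} (h1 : 1 ≤ i) (h2 : j ≤ n) (h3 : i ≤ k) (h4 : k < j) :
    ∃ e : Idx n, li e = i ∧ ri e = j ∧ ki e = k :=
  ⟨⟨⟨(i, j), mem_pairs.2 ⟨h1, h2, by simp only; omega⟩⟩, ⟨k - i, by simp only; omega⟩⟩,
    rfl, rfl, by simp only [ki]; omega⟩

noncomputable def cc (e : Idx n) : ℝ :=
  (ki e : ℝ) + ((li e * (n + 1) + ri e : ℕ) : ℝ) / ((n + 1 : ℕ) : ℝ) ^ 2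

lemma lt_cc (e : Idx n) : (ki e : ℝ) < cc e := by
  unfold cc
  have h : 0 < li e * (n + 1) + ri e := by have := li_lt_ri e; omega
  have h' : (0 : ℝ) < ((li e * (n + 1) + ri e : ℕ) : ℝ) := by exact_mod_cast h
  have : (0 : ℝ) < ((n + 1 : ℕ) : ℝ) := by exact_mod_cast Nat.succ_pos n
  have := div_pos h' (pow_pos this 2)
  linarith

lemma cc_lt (e : Idx n) : cc e < (ki e : ℝ) + 1 := by
  unfold cc
  have h : li e * (n + 1) + ri e < (n + 1) ^ 2 := by
    have := li_lt_ri e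
    have := ri_le e
    have : li e * (n + 1) ≤ n * (n + 1) := Nat.mul_le_mul_right _ (by omega)
    nlinarith
  have h' : ((li e * (n + 1) + ri e : ℕ) : ℝ) < ((n + 1 : ℕ) : ℝ) ^ 2 := by exact_mod_cast h
  have h0 : (0 : ℝ) < ((n + 1 : ℕ) : ℝ) := by exact_mod_cast Nat.succ_pos n
  have := (div_lt_one (pow_pos h0 2)).2 h'
  linarith

lemma li_lt_cc (e : Idx n) : (li e : ℝ) < cc e :=
  lt_of_le_of_lt (by exact_mod_cast li_le_ki e) (lt_cc e)

lemma cc_lt_ri (e : Idx n) : cc e < (ri e : ℝ) :=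
  lt_of_lt_of_le (cc_lt e) (by exact_mod_cast ki_lt_ri e)

lemma cc_ne_nat (e : Idx n) (m : ℕ) : (m : ℝ) ≠ cc e := by
  intro h
  have h1 := lt_cc e
  have h2 := cc_lt e
  rw [← h] at h1 h2
  have h1' : ki e < m := by exact_mod_cast h1
  have h2' : m < ki e + 1 := by exact_mod_cast h2
  omega

lemma cc_lt_of_ki {e f : Idx n} (h : ki e < ki f) : cc e < cc f := by
  have h1 := cc_lt e
  have h2 := lt_cc f
  have : (ki e : ℝ) + 1 ≤ ki f := by exact_mod_cast h
  linarith

lemma cc_inj {e f : Idx n} (h : cc e = cc f) : e = f := by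
  have hk : ki e = ki f := by
    rcases lt_trichotomy (ki e) (ki f) with h1 | h1 | h1
    · exact absurd h (cc_lt_of_ki h1).ne
    · exact h1
    · exact absurd h (cc_lt_of_ki h1).ne'
  have h0 : ((n + 1 : ℕ) : ℝ) ^ 2 ≠ 0 := pow_ne_zero 2 (by exact_mod_cast Nat.succ_ne_zero n)
  unfold cc at h
  rw [hk, add_right_inj, div_left_inj' h0] at h
  have h' : li e * (n + 1) + ri e = li f * (n + 1) + ri f := by exact_mod_cast h
  have a1 := ri_le e
  have a2 := ri_le f
  have hl : li e = li f := by
    rcases lt_trichotomy (li e) (li f) with h1 | h1 | h1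
    · nlinarith [Nat.mul_le_mul_right (n + 1) h1]
    · exact h1
    · nlinarith [Nat.mul_le_mul_right (n + 1) h1]
  refine idx_ext hl ?_ hk
  rw [hl] at h'
  omega

/-- The edge as function graph. -/
noncomputable def g (e : Idx n) : ℝ → ℝ := ff (li e) (ri e) (cc e)

noncomputable def xx (e : Idx n) (t : unitInterval) : ℝ :=
  (li e : ℝ) + (t : ℝ) * ((ri e : ℝ) - li e)

lemma li_lt_ri' (e : Idx n) : (li e : ℝ) < ri e := by exact_mod_cast li_lt_ri e

lemma xx_mem (e : Idx n) {t : unitInterval} (h0 : t ≠ 0) (h1 : t ≠ 1) :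
    (li e : ℝ) < xx e t ∧ xx e t < ri e := by
  have a := li_lt_ri' e
  have b : (0 : ℝ) < t := lt_of_le_of_ne t.2.1 (fun h => h0 (Subtype.ext h.symm))
  have c : (t : ℝ) < 1 := lt_of_le_of_ne t.2.2 (fun h => h1 (Subtype.ext h))
  unfold xx
  constructor <;> nlinarith

/-- The multigraph. -/
noncomputable def GG (n : ℕ) : TopMultigraph where
  V := (Finset.Icc 1 n).image (fun i : ℕ => ((i : ℝ), (0 : ℝ)))
  ι := Idx n
  fintype_ι := inferInstance
  arc := fun e t => (xx e t, g e (xx e t))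
  continuous_arc := by
    intro e
    have h : Continuous (xx e) := by unfold xx; fun_prop
    exact h.prodMk ((continuous_ff _ _ _).comp h)
  injective_arc := by
    intro e s t h
    have h1 : xx e s = xx e t := congrArg Prod.fst h
    have a := li_lt_ri' e
    unfold xx at h1
    have : (s : ℝ) = t := mul_right_cancel₀ (sub_ne_zero.2 a.ne') (by linarith)
    exact Subtype.ext this
  source_mem := by
    intro e
    rw [Finset.mem_image]
    refine ⟨li e, Finset.mem_Icc.2 ⟨li_pos e, (li_lt_ri e).le.trans (ri_le e)⟩, ?_⟩
    have : xx e 0 = li e := by simp [xx]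
    rw [this, g, ff_left (li_lt_cc e).le]
  target_mem := by
    intro e
    rw [Finset.mem_image]
    refine ⟨ri e, Finset.mem_Icc.2 ⟨(li_pos e).trans (li_lt_ri e).le, (ri_le e)⟩, ?_⟩
    have : xx e 1 = ri e := by simp [xx]
    rw [this, g, ff_right (cc_lt_ri e).le]
  ends_ne := by
    intro e h
    have h1 : xx e 0 = xx e 1 := congrArg Prod.fst h
    have a := li_lt_ri' e
    simp [xx] at h1
    have := li_lt_ri e
    omega
  interior_avoids := by
    intro e t h0 h1 h
    rw [Finset.mem_image] at h
    obtain ⟨m, -, hm⟩ := h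
    have a : (m : ℝ) = xx e t := congrArg Prod.fst hm
    have b : (0 : ℝ) = g e (xx e t) := congrArg Prod.snd hm
    obtain ⟨c, d⟩ := xx_mem e h0 h1
    exact cc_ne_nat e m (a.trans (eq_of_ff_zero c d b.symm))

lemma mem_int {e : Idx n} {p : ℝ × ℝ} (h : p ∈ (GG n).arcInterior e) :
    (li e : ℝ) < p.1 ∧ p.1 < ri e ∧ p.2 = g e p.1 := by
  obtain ⟨t, ⟨h0, h1⟩, rfl⟩ := h
  exact ⟨(xx_mem e h0 h1).1, (xx_mem e h0 h1).2, rfl⟩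

lemma arc_zero (e : Idx n) : (GG n).arc e 0 = ((li e : ℝ), (0 : ℝ)) := by
  change (xx e 0, g e (xx e 0)) = _
  have : xx e 0 = li e := by simp [xx]
  rw [this, g, ff_left (li_lt_cc e).le]

lemma arc_one (e : Idx n) : (GG n).arc e 1 = ((ri e : ℝ), (0 : ℝ)) := by
  change (xx e 1, g e (xx e 1)) = _
  have : xx e 1 = ri e := by simp [xx]
  rw [this, g, ff_right (cc_lt_ri e).le]

lemma endpoints_eq_iff {e f : Idx n} :
    (GG n).endpoints e = (GG n).endpoints f ↔ li e = li f ∧ ri e = ri f := by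
  unfold TopMultigraph.endpoints
  rw [arc_zero, arc_one, arc_zero, arc_one]
  constructor
  · intro h
    have a := li_lt_ri e
    have b := li_lt_ri f
    rw [Set.pair_eq_pair_iff] at h
    simp only [Prod.mk.injEq, Nat.cast_inj, and_true] at h
    omega
  · rintro ⟨h1, h2⟩
    rw [h1, h2]

lemma two_points {e f : Idx n} (hef : e ≠ f) :
    ∃ p q : ℝ × ℝ, (GG n).arcInterior e ∩ (GG n).arcInterior f ⊆ {p, q} := by
  set S := (GG n).arcInterior e ∩ (GG n).arcInterior f with hS
  have hc : cc e ≠ cc f := fun h => hef (cc_inj h)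
  have hz : ∀ p ∈ S, p.2 ≠ 0 := by
    rintro p ⟨h1, h2⟩ h0
    obtain ⟨a1, a2, a3⟩ := mem_int h1
    obtain ⟨b1, b2, b3⟩ := mem_int h2
    have u := eq_of_ff_zero a1 a2 (a3.symm.trans h0)
    have v := eq_of_ff_zero b1 b2 (b3.symm.trans h0)
    exact hc (u.symm.trans v)
  have hp : ∀ p ∈ S, ∀ q ∈ S, 0 < p.2 → 0 < q.2 → p = q := by
    rintro p ⟨h1, h2⟩ q ⟨h3, h4⟩ hp hq
    obtain ⟨a1, a2, a3⟩ := mem_int h1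
    obtain ⟨b1, b2, b3⟩ := mem_int h2
    obtain ⟨c1, c2, c3⟩ := mem_int h3
    obtain ⟨d1, d2, d3⟩ := mem_int h4
    have : p.1 = q.1 := ff_pos_unique (li_lt_cc e) (li_lt_cc f) a2 b2 c2 d2 hc
      (a3.symm.trans b3) (c3.symm.trans d3) (lt_of_lt_of_eq hp a3) (lt_of_lt_of_eq hq c3)
    refine Prod.ext this ?_
    rw [a3, c3, this]
  have hm : ∀ p ∈ S, ∀ q ∈ S, p.2 < 0 → q.2 < 0 → p = q := by
    rintro p ⟨h1, h2⟩ q ⟨h3, h4⟩ hp hq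
    obtain ⟨a1, a2, a3⟩ := mem_int h1
    obtain ⟨b1, b2, b3⟩ := mem_int h2
    obtain ⟨c1, c2, c3⟩ := mem_int h3
    obtain ⟨d1, d2, d3⟩ := mem_int h4
    have : p.1 = q.1 := ff_neg_unique (cc_lt_ri e) (cc_lt_ri f) a1 b1 c1 d1 hc
      (a3.symm.trans b3) (c3.symm.trans d3) (lt_of_eq_of_lt a3.symm hp)
      (lt_of_eq_of_lt c3.symm hq)
    refine Prod.ext this ?_
    rw [a3, c3, this]
  have key : ∀ P : ℝ × ℝ → Prop, (∀ p ∈ S, ∀ q ∈ S, P p → P q → p = q) →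
      ∃ p, ∀ q ∈ S, P q → q = p := by
    intro P hP
    by_cases h : ∃ p ∈ S, P p
    · obtain ⟨p, h1, h2⟩ := h
      exact ⟨p, fun q hq hq' => hP q hq p h1 hq' h2⟩
    · push Not at h
      exact ⟨0, fun q hq hq' => absurd hq' (h q hq)⟩
  obtain ⟨p, hp'⟩ := key _ hp
  obtain ⟨q, hq'⟩ := key _ hm
  refine ⟨p, q, fun z hz' => ?_⟩
  rcases lt_or_gt_of_ne (hz z hz') with h | h
  · exact Or.inr (hq' z hz' h)
  · exact Or.inl (hp' z hz' h)

lemma g_lt {e f : Idx n} (hl : li e = li f) (hr : ri e = ri f) (h : cc e < cc f) {x : ℝ}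
    (h1 : (li e : ℝ) < x) (h2 : x < ri e) : g e x < g f x := by
  unfold g
  rw [← hl, ← hr]
  exact ff_strictMono h1 h2 h

lemma par : (GG n).ParallelNoncrossing := by
  rintro e f ⟨hne, he⟩ ⟨p, h1, h2⟩
  obtain ⟨hl, hr⟩ := (endpoints_eq_iff (e := e) (f := f)).1 he
  obtain ⟨a1, a2, a3⟩ := mem_int h1
  obtain ⟨b1, b2, b3⟩ := mem_int h2
  rcases lt_trichotomy (cc e) (cc f) with h | h | h
  · have := g_lt hl hr h a1 a2
    linarith
  · exact hne (cc_inj h)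
  · have := g_lt hl.symm hr.symm h b1 b2
    linarith

lemma ray_up {U : Set (ℝ × ℝ)} {a b : ℝ} (h : ∀ y, b ≤ y → (a, y) ∈ U) :
    ¬ Bornology.IsBounded (connectedComponentIn U (a, b)) := by
  intro hb
  have hpre : IsPreconnected ((fun y : ℝ => (a, y)) '' Set.Ici b) :=
    isPreconnected_Ici.image _ (by fun_prop)
  have hsub := hpre.subset_connectedComponentIn (x := (a, b)) (F := U)
    ⟨b, Set.self_mem_Ici, rfl⟩ (by rintro _ ⟨y, hy, rfl⟩; exact h y hy)
  obtain ⟨R, hR⟩ := (hb.subset hsub).exists_norm_le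
  have := hR (a, max b (R + 1)) ⟨max b (R + 1), Set.mem_Ici.2 (le_max_left _ _), rfl⟩
  have h2 := (norm_snd_le (a, max b (R + 1))).trans this
  have h3 := (le_abs_self _).trans h2
  have h4 := le_max_right b (R + 1)
  simp only at h3
  linarith

lemma ray_down {U : Set (ℝ × ℝ)} {a b : ℝ} (h : ∀ y, y ≤ b → (a, y) ∈ U) :
    ¬ Bornology.IsBounded (connectedComponentIn U (a, b)) := by
  intro hb
  have hpre : IsPreconnected ((fun y : ℝ => (a, y)) '' Set.Iic b) :=
    isPreconnected_Iic.image _ (by fun_prop)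
  have hsub := hpre.subset_connectedComponentIn (x := (a, b)) (F := U)
    ⟨b, Set.self_mem_Iic, rfl⟩ (by rintro _ ⟨y, hy, rfl⟩; exact h y hy)
  obtain ⟨R, hR⟩ := (hb.subset hsub).exists_norm_le
  have := hR (a, min b (-(R + 1))) ⟨min b (-(R + 1)), Set.mem_Iic.2 (min_le_left _ _), rfl⟩
  have h2 := (norm_snd_le (a, min b (-(R + 1)))).trans this
  have h5 := (neg_le_abs _).trans h2
  have h4 := min_le_right b (-(R + 1))
  simp only at h5
  linarith

lemma region_preconnected {u v : ℝ → ℝ} (hu : Continuous u) (hv : Continuous v) (i j : ℝ)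
    (h : ∀ x, i < x → x < j → u x < v x) :
    IsPreconnected {p : ℝ × ℝ | i < p.1 ∧ p.1 < j ∧ u p.1 < p.2 ∧ p.2 < v p.1} := by
  have h1 : IsPreconnected (Set.Ioo i j ×ˢ Set.Ioo (0 : ℝ) 1) :=
    isPreconnected_Ioo.prod isPreconnected_Ioo
  have h2 := h1.image (fun p : ℝ × ℝ => (p.1, u p.1 + p.2 * (v p.1 - u p.1)))
    (by fun_prop)
  convert h2 using 1
  ext ⟨x, y⟩
  simp only [Set.mem_ofPred_eq, Set.mem_image, Set.mem_prod, Set.mem_Ioo, Prod.exists,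
    Prod.mk.injEq]
  constructor
  · rintro ⟨a, b, c, d⟩
    have e : 0 < v x - u x := sub_pos.2 (h x a b)
    refine ⟨x, (y - u x) / (v x - u x), ⟨⟨a, b⟩, div_pos (by linarith) e,
      (div_lt_one e).2 (by linarith)⟩, rfl, ?_⟩
    rw [div_mul_cancel₀ _ e.ne']; ring
  · rintro ⟨x', s, ⟨⟨a, b⟩, c, d⟩, rfl, rfl⟩
    have e : 0 < v x' - u x' := sub_pos.2 (h x' a b)
    refine ⟨a, b, ?_, ?_⟩ <;> nlinarith

lemma mem_range {e : Idx n} {p : ℝ × ℝ} :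
    p ∈ Set.range ((GG n).arc e) ↔ ((li e : ℝ) ≤ p.1 ∧ p.1 ≤ ri e ∧ p.2 = g e p.1) := by
  have a := li_lt_ri' e
  constructor
  · rintro ⟨t, rfl⟩
    change (li e : ℝ) ≤ xx e t ∧ xx e t ≤ ri e ∧ g e (xx e t) = g e (xx e t)
    have b := t.2.1
    have c := t.2.2
    refine ⟨?_, ?_, rfl⟩ <;> unfold xx <;> nlinarith
  · rintro ⟨h1, h2, h3⟩
    have e0 : 0 < (ri e : ℝ) - li e := sub_pos.2 a
    refine ⟨⟨(p.1 - li e) / (ri e - li e), div_nonneg (by linarith) e0.le,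
      (div_le_one e0).2 (by linarith)⟩, ?_⟩
    have : xx e ⟨(p.1 - li e) / (ri e - li e), div_nonneg (by linarith) e0.le,
      (div_le_one e0).2 (by linarith)⟩ = p.1 := by
      unfold xx
      simp only
      rw [div_mul_cancel₀ _ e0.ne']; ring
    change (xx e _, g e (xx e _)) = p
    rw [this, ← h3]

lemma lens (ℓ : Set (ℝ × ℝ)) (hl : (GG n).IsLens ℓ) : ∃ v ∈ (GG n).V, v ∈ ℓ := by
  obtain ⟨u, v, -, ⟨e, he⟩, -, hb, ⟨a, b⟩, hx, rfl⟩ := hl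
  change Idx n at e
  have hU : ∀ p : ℝ × ℝ, p ∈ ((GG n).pairUnion u v)ᶜ ↔
      ∀ f : Idx n, li f = li e → ri f = ri e →
        ¬ ((li e : ℝ) ≤ p.1 ∧ p.1 ≤ ri e ∧ p.2 = g f p.1) := by
    intro p
    unfold TopMultigraph.pairUnion
    simp only [Set.mem_compl_iff, Set.mem_iUnion, not_exists, Set.mem_ofPred_eq]
    constructor
    · intro h f h1 h2 h3
      refine h f ?_ (mem_range.2 (by rw [h1, h2]; exact h3))
      exact ((endpoints_eq_iff (e := f) (f := e)).2 ⟨h1, h2⟩).trans he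
    · intro h f hf hp
      obtain ⟨h1, h2⟩ := (endpoints_eq_iff (e := f) (f := e)).1 (hf.trans he.symm)
      have h3 := mem_range.1 hp
      rw [h1, h2] at h3
      exact h f h1 h2 h3
  by_cases hup : ∀ y, b ≤ y → (a, y) ∈ ((GG n).pairUnion u v)ᶜ
  · exact absurd hb (ray_up hup)
  by_cases hdn : ∀ y, y ≤ b → (a, y) ∈ ((GG n).pairUnion u v)ᶜ
  · exact absurd hb (ray_down hdn)
  push Not at hup hdn
  obtain ⟨y, hy, hy'⟩ := hup
  obtain ⟨z, hz, hz'⟩ := hdn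
  rw [hU] at hy' hz'
  push Not at hy' hz'
  obtain ⟨f1, l1, r1, m1, m2, m3⟩ := hy'
  obtain ⟨f2, l2, r2, _, _, m6⟩ := hz'
  have hx' := (hU _).1 hx
  simp only at m1 m2 m3 m6 hx'
  have ne : ∀ f : Idx n, li f = li e → ri f = ri e → b ≠ g f a :=
    fun f h1 h2 h3 => hx' f h1 h2 ⟨m1, m2, h3⟩
  have q1 : b < g f1 a := lt_of_le_of_ne (m3 ▸ hy) (ne f1 l1 r1)
  have q2 : g f2 a < b := lt_of_le_of_ne (m6 ▸ hz) (ne f2 l2 r2).symm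
  have hia : (li e : ℝ) < a := by
    refine lt_of_le_of_ne m1 fun h => ?_
    have t1 : g f1 a = 0 := by
      unfold g; rw [← h, ← l1]; exact ff_left (li_lt_cc f1).le
    have t2 : g f2 a = 0 := by
      unfold g; rw [← h, ← l2]; exact ff_left (li_lt_cc f2).le
    linarith
  have haj : a < (ri e : ℝ) := by
    refine lt_of_le_of_ne m2 fun h => ?_
    have t1 : g f1 a = 0 := by
      unfold g; rw [h, ← r1]; exact ff_right (cc_lt_ri f1).le
    have t2 : g f2 a = 0 := by
      unfold g; rw [h, ← r2]; exact ff_right (cc_lt_ri f2).le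
    linarith
  -- the highest edge below the point
  obtain ⟨f, hf, hmax⟩ := Finset.exists_max_image
    (Finset.univ.filter (fun f : Idx n => li f = li e ∧ ri f = ri e ∧ g f a < b)) ki
    ⟨f2, by simp [l2, r2, q2]⟩
  simp only [Finset.mem_filter, Finset.mem_univ, true_and] at hf hmax
  obtain ⟨lf, rf, gf⟩ := hf
  have hk : ki f + 1 < ri e := by
    have h1 : ki f < ki f1 := by
      by_contra hcon
      rcases (not_lt.1 hcon).lt_or_eq with h | h
      · have := g_lt (l1.trans lf.symm) (r1.trans rf.symm) (cc_lt_of_ki h)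
          (x := a) (by rw [l1]; exact hia) (by rw [r1]; exact haj)
        linarith
      · have : f1 = f := idx_ext (l1.trans lf.symm) (r1.trans rf.symm) h
        rw [this] at q1
        linarith
    have := ki_lt_ri f1
    omega
  obtain ⟨f', lf', rf', kf'⟩ := idx_exists (n := n) (i := li e) (j := ri e) (k := ki f + 1)
    (li_pos e) (ri_le e) (by have := li_le_ki f; omega) hk
  have gf' : b < g f' a := by
    by_contra hcon
    have h := lt_of_le_of_ne (not_lt.1 hcon) (ne f' lf' rf').symm
    have := hmax f' ⟨lf', rf', h⟩
    omega
  have hcc : cc f < cc f' := cc_lt_of_ki (by omega)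
  have hlt : ∀ x, (li e : ℝ) < x → x < ri e → g f x < g f' x := fun x h1 h2 =>
    g_lt (lf.trans lf'.symm) (rf.trans rf'.symm) hcc (by rw [lf]; exact h1) (by rw [rf]; exact h2)
  have hpre := region_preconnected (u := g f) (v := g f') (continuous_ff _ _ _)
    (continuous_ff _ _ _) (li e) (ri e) hlt
  have hsub := hpre.subset_connectedComponentIn (x := (a, b)) (F := ((GG n).pairUnion u v)ᶜ)
    ⟨hia, haj, gf, gf'⟩ (by
      rintro ⟨x, y⟩ ⟨w1, w2, w3, w4⟩
      rw [hU]
      rintro h lh rh ⟨-, -, hh⟩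
      simp only at w1 w2 w3 w4 hh
      have x1 : (li h : ℝ) < x := by rw [lh]; exact w1
      have x2 : x < (ri h : ℝ) := by rw [rh]; exact w2
      rcases lt_trichotomy (ki h) (ki f) with t | t | t
      · have := g_lt (lh.trans lf.symm) (rh.trans rf.symm) (cc_lt_of_ki t) x1 x2
        linarith
      · have : h = f := idx_ext (lh.trans lf.symm) (rh.trans rf.symm) t
        rw [this] at hh
        linarith
      · rcases Nat.lt_or_ge (ki f') (ki h) with t' | t'
        · have := g_lt (lf'.trans lh.symm) (rf'.trans rh.symm) (cc_lt_of_ki t') (x := x)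
            (by rw [lf']; exact w1) (by rw [rf']; exact w2)
          linarith
        · have : h = f' := idx_ext (lh.trans lf'.symm) (rh.trans rf'.symm) (by omega)
          rw [this] at hh
          linarith)
  have k1 := li_le_ki f
  have k2 : (li e : ℝ) < ((ki f + 1 : ℕ) : ℝ) := by exact_mod_cast (by omega : li e < ki f + 1)
  have k3 : ((ki f + 1 : ℕ) : ℝ) < ri e := by exact_mod_cast hk
  refine ⟨(((ki f + 1 : ℕ) : ℝ), 0), ?_, hsub ⟨k2, k3, ?_, ?_⟩⟩
  · change _ ∈ (Finset.Icc 1 n).image (fun i : ℕ => ((i : ℝ), (0 : ℝ)))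
    have := ri_le e
    exact Finset.mem_image.2 ⟨ki f + 1, Finset.mem_Icc.2 ⟨by omega, by omega⟩, rfl⟩
  · refine ff_neg (by rw [rf]; exact k3) ?_
    have := cc_lt f
    push_cast
    exact this
  · refine ff_pos (by rw [lf']; exact k2) ?_
    have := lt_cc f'
    rw [kf'] at this
    exact this

lemma card_edges : (GG n).edgeCount = ∑ p ∈ pairs n, (p.2 - p.1) := by
  change Nat.card (Idx n) = _
  rw [Nat.card_eq_fintype_card, Fintype.card_sigma]
  simp only [Fintype.card_fin]
  exact Finset.sum_coe_sort (pairs n) (fun p => p.2 - p.1)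

lemma sum_pairs (n : ℕ) : ∑ p ∈ pairs n, (p.2 - p.1) =
    ∑ i ∈ Finset.Icc 1 n, ∑ j ∈ Finset.Icc 1 n, (j - i) := by
  unfold pairs
  rw [Finset.sum_filter, Finset.sum_product]
  refine Finset.sum_congr rfl fun i _ => Finset.sum_congr rfl fun j _ => ?_
  split_ifs with h
  · rfl
  · simp only at h ⊢
    omega

lemma sum_lin (n : ℕ) : 2 * ∑ i ∈ Finset.Icc 1 n, (n + 1 - i) = n * (n + 1) := by
  induction n with
  | zero => simp
  | succ n ih =>
    rw [Finset.sum_Icc_succ_top (by omega)]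
    have : ∑ i ∈ Finset.Icc 1 n, (n + 1 + 1 - i) = ∑ i ∈ Finset.Icc 1 n, ((n + 1 - i) + 1) := by
      refine Finset.sum_congr rfl fun i hi => ?_
      have := Finset.mem_Icc.1 hi
      omega
    rw [this, Finset.sum_add_distrib]
    simp only [Finset.sum_const, Nat.card_Icc, smul_eq_mul]
    have h2 : n + 1 + 1 - (n + 1) = 1 := by omega
    rw [h2, Nat.add_sub_cancel]
    linarith

lemma sum_closed (n : ℕ) :
    6 * (∑ i ∈ Finset.Icc 1 n, ∑ j ∈ Finset.Icc 1 n, (j - i)) + n = n ^ 3 := by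
  induction n with
  | zero => simp
  | succ n ih =>
    rw [Finset.sum_Icc_succ_top (by omega)]
    have h0 : ∑ j ∈ Finset.Icc 1 (n + 1), (j - (n + 1)) = 0 := by
      refine Finset.sum_eq_zero fun j hj => ?_
      have := Finset.mem_Icc.1 hj
      omega
    have h1 : ∀ i, ∑ j ∈ Finset.Icc 1 (n + 1), (j - i) =
        ∑ j ∈ Finset.Icc 1 n, (j - i) + (n + 1 - i) := fun i =>
      Finset.sum_Icc_succ_top (by omega) _
    rw [h0, Finset.sum_congr rfl (fun i _ => h1 i), Finset.sum_add_distrib]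
    have := sum_lin n
    nlinarith

end DoubleCrossing

/-- **Lower bound construction.** For every `n ≥ 2` there is a topological multigraph on the
vertex set `{(1,0), …, (n,0)}` with exactly `Σ_{1 ≤ i < j ≤ n} (j - i) = (n³ - n)/6` edges in
which any two distinct edges share at most two common interior points, no two parallel edges
cross, and every lens contains a vertex. In particular, there are separated topological
multigraphs in which any two edges cross at most twice having `Ω(n³)` edges. -/
theorem exists_separated_double_crossing_many_edges (n : ℕ) (hn : 2 ≤ n) :
    ∃ G : TopMultigraph,
      G.V = (Finset.Icc 1 n).image (fun i : ℕ => ((i : ℝ), (0 : ℝ))) ∧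
      G.edgeCount = ∑ p ∈ (Finset.Icc 1 n ×ˢ Finset.Icc 1 n).filter (fun p => p.1 < p.2),
        (p.2 - p.1) ∧
      G.edgeCount = (n ^ 3 - n) / 6 ∧
      (∀ e f : G.ι, e ≠ f →
        ∃ p q : ℝ × ℝ, G.arcInterior e ∩ G.arcInterior f ⊆ {p, q}) ∧
      G.ParallelNoncrossing ∧
      (∀ ℓ, G.IsLens ℓ → ∃ v ∈ G.V, v ∈ ℓ) := by
  have hs : (DoubleCrossing.GG n).edgeCount = ∑ p ∈ DoubleCrossing.pairs n, (p.2 - p.1) :=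
    DoubleCrossing.card_edges
  refine ⟨DoubleCrossing.GG n, rfl, hs, ?_, fun e f h => DoubleCrossing.two_points h,
    DoubleCrossing.par, DoubleCrossing.lens⟩
  have h := DoubleCrossing.sum_closed n
  rw [hs, DoubleCrossing.sum_pairs]
  omega
end

section
/- In a separated topological multigraph G on n vertices, every pair of distinct vertices is joined by at most n − 1 parallel edges; consequently, |E(G)| ≤ C(n,2)·(n − 1). -/
open Set

namespace PlaneSep

open Complex Topology

set_option linter.unusedSectionVars false

/-- Real induction along overlapping windows. -/
theorem chain (P : ℝ → Prop)
    (hloc : ∀ c : ℝ, ∃ ε > 0, ∀ a b, c - ε < a → a < b → b < c + ε → P a → P b)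
    (a b : ℝ) (hab : a ≤ b) (ha : P a) : P b := by
  choose ε hε hP using hloc
  obtain ⟨t, h0, hm, ⟨m, hm'⟩, hc⟩ := exists_monotone_Icc_subset_open_cover_Icc hab
    (c := fun i : ℝ => {x : Icc a b | i - ε i < x.1 ∧ x.1 < i + ε i})
    (fun i => by
      apply IsOpen.inter
      · exact isOpen_lt continuous_const continuous_subtype_val
      · exact isOpen_lt continuous_subtype_val continuous_const)
    (fun x _ => by
      rw [mem_iUnion]
      exact ⟨x.1, by have := hε x.1; constructor <;> linarith⟩)
  have key : ∀ n, P (t n).1 := by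
    intro n
    induction n with
    | zero => rw [h0]; exact ha
    | succ k ih =>
      obtain ⟨i, hi⟩ := hc k
      have hle : t k ≤ t (k+1) := hm (Nat.le_succ k)
      have h1 := hi (left_mem_Icc.2 hle)
      have h2 := hi (right_mem_Icc.2 hle)
      rcases hle.eq_or_lt with h | h
      · rw [← h]; exact ih
      · exact hP i _ _ h1.1 h h2.2 ih
  have := key m
  rwa [hm' m le_rfl] at this

/-- `F` has a continuous logarithm on `A`. -/
def LogOn {X : Type} [TopologicalSpace X] (F : X → ℂ) (A : Set X) : Prop :=
  ∃ g : X → ℂ, ContinuousOn g A ∧ ∀ x ∈ A, F x = exp (g x)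

section
variable {X : Type} [TopologicalSpace X]

theorem LogOn.mono {F : X → ℂ} {A B : Set X} (h : LogOn F B) (hAB : A ⊆ B) : LogOn F A := by
  obtain ⟨g, hg, h⟩ := h
  exact ⟨g, hg.mono hAB, fun x hx => h x (hAB hx)⟩

theorem LogOn.mul {F G : X → ℂ} {A : Set X} (h : LogOn F A) (h' : LogOn G A) :
    LogOn (fun x => F x * G x) A := by
  obtain ⟨g, hg, h⟩ := h
  obtain ⟨g', hg', h'⟩ := h'
  exact ⟨fun x => g x + g' x, hg.add hg', fun x hx => by
    beta_reduce; rw [exp_add, h x hx, h' x hx]⟩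

theorem LogOn.zpow {F : X → ℂ} {A : Set X} (h : LogOn F A) (m : ℤ) :
    LogOn (fun x => F x ^ m) A := by
  obtain ⟨g, hg, h⟩ := h
  exact ⟨fun x => m * g x, continuousOn_const.mul hg, fun x hx => by
    beta_reduce; rw [exp_int_mul, h x hx]⟩

theorem LogOn.div {F G : X → ℂ} {A : Set X} (h : LogOn F A) (h' : LogOn G A) :
    LogOn (fun x => F x / G x) A := by
  obtain ⟨g, hg, h⟩ := h
  obtain ⟨g', hg', h'⟩ := h'
  exact ⟨fun x => g x - g' x, hg.sub hg', fun x hx => by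
    beta_reduce; rw [exp_sub, h x hx, h' x hx]⟩

theorem logOn_const {A : Set X} (k : ℂ) (hk : k ≠ 0) : LogOn (fun _ : X => k) A :=
  ⟨fun _ => log k, continuousOn_const, fun _ _ => (exp_log hk).symm⟩

theorem logOn_slit {F : X → ℂ} {A : Set X} (hF : ContinuousOn F A)
    (h : ∀ x ∈ A, F x ∈ slitPlane) : LogOn F A :=
  ⟨fun x => log (F x), hF.clog h, fun x hx => (exp_log (slitPlane_ne_zero (h x hx))).symm⟩

theorem LogOn.congr {F G : X → ℂ} {A : Set X} (h : LogOn F A) (e : ∀ x ∈ A, G x = F x) :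
    LogOn G A := by
  obtain ⟨g, hg, h⟩ := h
  exact ⟨g, hg, fun x hx => by rw [e x hx, h x hx]⟩

theorem glue {F : X → ℂ} {A B : Set X} (hA : IsClosed A) (hB : IsClosed B) {g₁ g₂ : X → ℂ}
    (h₁ : ContinuousOn g₁ A) (h₂ : ContinuousOn g₂ B) (e₁ : ∀ x ∈ A, F x = exp (g₁ x))
    (e₂ : ∀ x ∈ B, F x = exp (g₂ x)) (hab : ∀ x ∈ A, x ∈ B → g₁ x = g₂ x) :
    LogOn F (A ∪ B) := by
  classical
  have ea : ∀ x ∈ A, (fun x => if x ∈ A then g₁ x else g₂ x) x = g₁ x := fun x hx => by simp [hx]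
  have eb : ∀ x ∈ B, (fun x => if x ∈ A then g₁ x else g₂ x) x = g₂ x := fun x hx => by
    by_cases h : x ∈ A
    · simp [h, hab x h hx]
    · simp [h]
  refine ⟨fun x => if x ∈ A then g₁ x else g₂ x, ?_, ?_⟩
  · exact (h₁.congr ea).union_of_isClosed (h₂.congr eb) hA hB
  · rintro x (hx | hx)
    · rw [ea x hx, e₁ x hx]
    · rw [eb x hx, e₂ x hx]

variable [CompactSpace X] [T2Space X]

theorem window {Y : Type} [PseudoMetricSpace Y] [T2Space Y] {h : X → Y} (hh : Continuous h) (c : Y)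
    {U : Set X} (hU : IsOpen U) (hc : ∀ x, h x = c → x ∈ U) :
    ∃ ε > 0, ∀ x, dist (h x) c < ε → x ∈ U := by
  have := hh.isClosedMap.eventually_nhds_fiber (p := fun x => x ∈ U) c
    (fun x hx => hU.mem_nhds (hc x hx))
  rw [Metric.eventually_nhds_iff] at this
  obtain ⟨ε, h0, h1⟩ := this
  exact ⟨ε, h0, fun x hx => h1 hx x rfl⟩

theorem exists_lower {h : X → ℝ} (hh : Continuous h) : ∃ a, ∀ x, a < h x := by
  obtain ⟨a, ha⟩ := (isCompact_range hh).bddBelow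
  exact ⟨a - 1, fun x => by have := ha (mem_range_self x); linarith⟩

theorem exists_upper {h : X → ℝ} (hh : Continuous h) : ∃ a, ∀ x, h x < a := by
  obtain ⟨a, ha⟩ := (isCompact_range hh).bddAbove
  exact ⟨a + 1, fun x => by have := ha (mem_range_self x); linarith⟩

variable {p : X → ℂ}

theorem line_log {p : X → ℂ} (hp : Continuous p) (hi : Function.Injective p)
    {F : X → ℂ} (hF : Continuous F) (h0 : ∀ x, F x ≠ 0) (c : ℝ) :
    LogOn F {x | (p x).re = c} := by
  have hre : Continuous fun x => (p x).re := continuous_re.comp hp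
  have him : Continuous fun x => (p x).im := continuous_im.comp hp
  obtain ⟨a, ha⟩ := exists_lower him
  obtain ⟨b, hb⟩ := exists_upper him
  have hT : IsClosed {x | (p x).re = c} := isClosed_eq hre continuous_const
  have key : LogOn F ({x | (p x).re = c} ∩ {x | (p x).im ≤ max a b}) := by
    refine chain (fun y => LogOn F ({x | (p x).re = c} ∩ {x | (p x).im ≤ y})) ?_ a _
      (le_max_left a b) ?_
    · intro y
      have : ∃ U : Set X, IsOpen U ∧ (∀ x, p x = ⟨c, y⟩ → x ∈ U) ∧ LogOn F U := by
        by_cases h : ∃ x₀, p x₀ = ⟨c, y⟩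
        · obtain ⟨x₀, hx₀⟩ := h
          refine ⟨{x | F x / F x₀ ∈ slitPlane},
            isOpen_slitPlane.preimage (hF.div_const _), ?_, ?_⟩
          · intro x hx
            have : x = x₀ := hi (hx.trans hx₀.symm)
            simp [this, h0 x₀]
          · refine ((logOn_slit (F := fun x => F x / F x₀) (hF.div_const _).continuousOn
              (fun x hx => hx)).mul (logOn_const (F x₀) (h0 x₀))).congr ?_
            intro x _
            field_simp [h0 x₀]
        · exact ⟨∅, isOpen_empty, fun x hx => (h ⟨x, hx⟩).elim, 0, by simp, by simp⟩
      obtain ⟨U, hU, hcU, hlog⟩ := this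
      obtain ⟨ε, hε, hw⟩ := window hp _ hU hcU
      refine ⟨ε, hε, fun a b ha hab hb hPa => ?_⟩
      obtain ⟨g₁, hg₁, e₁⟩ := hPa
      have hsub : {x | (p x).re = c} ∩ {x | a ≤ (p x).im ∧ (p x).im ≤ b} ⊆ U := by
        rintro x ⟨hx, hx1, hx2⟩
        apply hw
        simp only [mem_ofPred_eq] at hx
        rw [Complex.dist_of_re_eq (by simpa using hx), Real.dist_eq, abs_lt]
        constructor <;> simp <;> linarith
      obtain ⟨g₂, hg₂, e₂⟩ := hlog.mono hsub
      have hk : ∃ k : ℂ, exp k = 1 ∧ ∀ x, (p x).re = c → (p x).im = a → g₁ x = g₂ x + k := by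
        by_cases h : ∃ x₀, p x₀ = ⟨c, a⟩
        · obtain ⟨x₀, hx₀⟩ := h
          refine ⟨g₁ x₀ - g₂ x₀, ?_, ?_⟩
          · rw [exp_sub, ← e₁ x₀ (by simp [hx₀]), ← e₂ x₀ (by simp [hx₀, hab.le]), div_self (h0 x₀)]
          · intro x h1 h2
            have : x = x₀ := hi (by rw [hx₀]; exact Complex.ext h1 h2)
            rw [this]; ring
        · exact ⟨0, by simp, fun x h1 h2 => (h ⟨x, Complex.ext h1 h2⟩).elim⟩
      obtain ⟨k, hk1, hk⟩ := hk
      refine (glue (A := {x | (p x).re = c} ∩ {x | (p x).im ≤ a})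
        (B := {x | (p x).re = c} ∩ {x | a ≤ (p x).im ∧ (p x).im ≤ b}) (F := F) (g₁ := g₁)
        (g₂ := fun x => g₂ x + k) (hT.inter (isClosed_le him continuous_const))
        (hT.inter ((isClosed_le continuous_const him).inter (isClosed_le him continuous_const)))
        hg₁ (hg₂.add continuousOn_const) e₁
        (fun x hx => by rw [exp_add, hk1, mul_one, e₂ x hx]) ?_).mono ?_
      · rintro x ⟨hx, hx1⟩ ⟨_, hx2, _⟩
        exact hk x hx (le_antisymm hx1 hx2)
      · rintro x ⟨hx, hx1⟩
        rcases le_total (p x).im a with h | h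
        · exact Or.inl ⟨hx, h⟩
        · exact Or.inr ⟨hx, h, hx1⟩
    · refine ⟨0, continuousOn_const, ?_⟩
      rintro x ⟨_, hx⟩
      exact absurd hx (not_le.2 (ha x))
  exact key.mono fun x hx => ⟨hx, (hb x).le.trans (le_max_right a b)⟩

theorem slab_log {p : X → ℂ} (hp : Continuous p) (hi : Function.Injective p)
    {F : X → ℂ} (hF : Continuous F) (h0 : ∀ x, F x ≠ 0) (c : ℝ) :
    ∃ ε > 0, LogOn F {x | dist (p x).re c < ε} := by
  have hre : Continuous fun x => (p x).re := continuous_re.comp hp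
  obtain ⟨g, hg, e⟩ := line_log hp hi hF h0 c
  have hT : IsClosed {x | (p x).re = c} := isClosed_eq hre continuous_const
  obtain ⟨G, hG⟩ := ContinuousMap.exists_restrict_eq hT ⟨_, hg.domRestrict⟩
  have hG' : ∀ x, (p x).re = c → G x = g x := fun x hx => by
    have := DFunLike.congr_fun hG ⟨x, hx⟩
    simpa using this
  have hc : Continuous fun x => F x / exp (G x) :=
    hF.div (continuous_exp.comp G.continuous) (fun x => exp_ne_zero _)
  obtain ⟨ε, hε, hw⟩ := window hre c (isOpen_slitPlane.preimage hc) (fun x hx => by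
    show F x / exp (G x) ∈ slitPlane
    rw [hG' x hx, e x hx, div_self (exp_ne_zero _)]; simp)
  refine ⟨ε, hε, ?_⟩
  have h1 : LogOn (fun x => F x / exp (G x)) {x | dist (p x).re c < ε} :=
    logOn_slit hc.continuousOn (fun x hx => hw x hx)
  have h2 : LogOn (fun x => exp (G x)) {x | dist (p x).re c < ε} :=
    ⟨G, G.continuous.continuousOn, fun _ _ => rfl⟩
  refine (h1.mul h2).congr fun x _ => ?_
  rw [div_mul_cancel₀ _ (exp_ne_zero _)]

/-- Products of integral powers of `p - q`, for `q ∈ Q`. -/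
inductive Gen (p : X → ℂ) (Q : Set ℂ) : (X → ℂ) → Prop
  | one : Gen p Q (fun _ => 1)
  | mul (f : X → ℂ) (q : ℂ) (hq : q ∈ Q) (m : ℤ) (hf : Gen p Q f) :
      Gen p Q (fun x => f x * (p x - q) ^ m)

theorem Gen.mono {Q Q' : Set ℂ} (h : Q ⊆ Q') {f : X → ℂ} (hf : Gen p Q f) : Gen p Q' f := by
  induction hf with
  | one => exact Gen.one
  | mul f q hq m _ ih => exact Gen.mul f q (h hq) m ih

theorem Gen.mul' {Q : Set ℂ} {f f' : X → ℂ} (hf : Gen p Q f) (hf' : Gen p Q f') :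
    Gen p Q (fun x => f x * f' x) := by
  induction hf' with
  | one => simpa using hf
  | mul f' q hq m _ ih =>
    have := Gen.mul _ q hq m ih
    simpa only [mul_assoc] using this

theorem Gen.ne_zero {Q : Set ℂ} (hQ : ∀ q ∈ Q, ∀ x, p x ≠ q) {f : X → ℂ} (hf : Gen p Q f) (x : X) :
    f x ≠ 0 := by
  induction hf with
  | one => exact one_ne_zero
  | mul f q hq m _ ih => exact mul_ne_zero ih (zpow_ne_zero _ (sub_ne_zero.2 (hQ q hq x)))

theorem Gen.logOn {p : X → ℂ} (hp : Continuous p)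
    {c : ℝ} {Q : Set ℂ} (hQ : ∀ q ∈ Q, q.re < c) {f : X → ℂ} (hf : Gen p Q f) :
    LogOn f {x | c ≤ (p x).re} := by
  induction hf with
  | one => exact logOn_const 1 one_ne_zero
  | mul f q hq m _ ih =>
    refine ih.mul (LogOn.zpow (F := fun x => p x - q) (logOn_slit ?_ ?_) m)
    · exact (hp.sub continuous_const).continuousOn
    · intro x hx
      refine Or.inl ?_
      have h1 : c ≤ (p x).re := hx
      have := hQ q hq
      rw [sub_re]; linarith

theorem log_jump (z : ℂ) (hre : z.re = 0) (him : z.im ≠ 0) :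
    log (-z) - Real.pi * I - log z = if 0 < z.im then -(2 * Real.pi * I) else 0 := by
  have hz : z = z.im * I := by apply Complex.ext <;> simp [hre]
  rcases lt_or_gt_of_ne him with h | h
  · rw [if_neg (not_lt.2 h.le), log, log, arg_eq_pi_div_two_iff.2 ⟨by simp [hre], by simpa using h⟩,
      arg_eq_neg_pi_div_two_iff.2 ⟨hre, h⟩]
    simp; ring
  · rw [if_pos h, log, log, arg_eq_neg_pi_div_two_iff.2 ⟨by simp [hre], by simpa using h⟩,
      arg_eq_pi_div_two_iff.2 ⟨hre, h⟩]
    simp; ring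

theorem step_fun {p : X → ℂ} (hp : Continuous p) (hi : Function.Injective p)
    (c : ℝ) (g : X → ℂ) (hg : ContinuousOn g {x | (p x).re = c})
    (hg1 : ∀ x, (p x).re = c → exp (g x) = 1) :
    ∃ ρ l₁ l₂ : X → ℂ, Gen p {q | q.re = c ∧ ∀ x, p x ≠ q} ρ ∧
      ContinuousOn l₁ {x | (p x).re ≤ c} ∧ (∀ x, (p x).re ≤ c → ρ x = exp (l₁ x)) ∧
      ContinuousOn l₂ {x | c ≤ (p x).re} ∧ (∀ x, c ≤ (p x).re → ρ x = exp (l₂ x)) ∧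
      ∀ x, (p x).re = c → l₁ x - l₂ x = g x := by
  have hre : Continuous fun x => (p x).re := continuous_re.comp hp
  have him : Continuous fun x => (p x).im := continuous_im.comp hp
  have hT : IsClosed {x | (p x).re = c} := isClosed_eq hre continuous_const
  obtain ⟨a, ha⟩ := exists_lower him
  obtain ⟨b, hb⟩ := exists_upper him
  let P : ℝ → Prop := fun y =>
    ∃ (ρ l₁ l₂ : X → ℂ) (k : ℂ), Gen p {q | q.re = c ∧ ∀ x, p x ≠ q} ρ ∧
      ContinuousOn l₁ {x | (p x).re ≤ c} ∧ (∀ x, (p x).re ≤ c → ρ x = exp (l₁ x)) ∧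
      ContinuousOn l₂ {x | c ≤ (p x).re} ∧ (∀ x, c ≤ (p x).re → ρ x = exp (l₂ x)) ∧
      (∀ x, (p x).re = c → (p x).im ≤ y → l₁ x - l₂ x = g x) ∧
      (exp k = 1 ∧ ∀ x, (p x).re = c → y ≤ (p x).im → l₁ x - l₂ x = k)
  suffices hP : P (max a b) by
    obtain ⟨ρ, l₁, l₂, k, h1, h2, h3, h4, h5, h6, -⟩ := hP
    exact ⟨ρ, l₁, l₂, h1, h2, h3, h4, h5,
      fun x hx => h6 x hx ((hb x).le.trans (le_max_right a b))⟩
  refine chain P ?_ a (max a b) (le_max_left a b) ?_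
  · intro y
    -- `g` is constant near height `y`
    have hconst : ∃ ε > 0, ∃ n : ℂ, exp n = 1 ∧
        ∀ x, (p x).re = c → dist (p x).im y < ε → g x = n := by
      by_cases h : ∃ x₀, p x₀ = ⟨c, y⟩
      · obtain ⟨x₀, hx₀⟩ := h
        have hx0c : (p x₀).re = c := by rw [hx₀]
        obtain ⟨G, hG⟩ := ContinuousMap.exists_restrict_eq hT ⟨_, hg.domRestrict⟩
        have hG' : ∀ x, (p x).re = c → G x = g x := fun x hx => by
          have := DFunLike.congr_fun hG ⟨x, hx⟩
          simpa using this
        obtain ⟨ε, hε, hw⟩ := window hp (⟨c, y⟩ : ℂ) (U := {x | ‖G x - G x₀‖ < 1})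
          (isOpen_lt (G.continuous.sub continuous_const).norm continuous_const)
          (fun x hx => by
            have : x = x₀ := hi (hx.trans hx₀.symm)
            simp [this])
        refine ⟨ε, hε, g x₀, hg1 x₀ hx0c, fun x hx hd => ?_⟩
        have h1 := hw x (by rw [Complex.dist_of_re_eq (by simpa using hx)]; exact hd)
        have h1 : ‖G x - G x₀‖ < 1 := h1
        rw [hG' x hx, hG' x₀ hx0c] at h1
        have h2 : exp (g x - g x₀) = 1 := by rw [exp_sub, hg1 x hx, hg1 x₀ hx0c, div_one]
        obtain ⟨n, hn⟩ := exp_eq_one_iff.1 h2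
        have hn0 : n = 0 := by
          by_contra hne
          have h3 : (1:ℝ) ≤ |(n:ℝ)| := by exact_mod_cast Int.one_le_abs hne
          rw [hn] at h1
          simp [abs_of_pos Real.pi_pos] at h1
          nlinarith [Real.pi_gt_three]
        rw [hn0] at hn
        simpa [sub_eq_zero] using hn
      · obtain ⟨ε, hε, hw⟩ := window hp (⟨c, y⟩ : ℂ) (U := ∅) isOpen_empty
          (fun x hx => (h ⟨x, hx⟩).elim)
        refine ⟨ε, hε, 0, exp_zero, fun x hx hd => ?_⟩
        exact (hw x (by rw [Complex.dist_of_re_eq (by simpa using hx)]; exact hd)).elim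
    obtain ⟨ε, hε, n, hn1, hn⟩ := hconst
    refine ⟨ε, hε, fun a b ha hab hb => ?_⟩
    rintro ⟨ρ, l₁, l₂, k, h1, h2, h3, h4, h5, h6, hk1, hk⟩
    have hwin : ∀ x, (p x).re = c → a ≤ (p x).im → (p x).im ≤ b → g x = n := by
      intro x hx hxa hxb
      apply hn x hx
      rw [Real.dist_eq, abs_lt]; constructor <;> linarith
    by_cases hx : ∃ x₀, p x₀ = ⟨c, a⟩
    · obtain ⟨x₀, hx₀⟩ := hx
      have hx0c : (p x₀).re = c := by rw [hx₀]
      have hx0a : (p x₀).im = a := by rw [hx₀]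
      have hkn : k = n := by
        rw [← hk x₀ hx0c hx0a.ge, h6 x₀ hx0c hx0a.le, hwin x₀ hx0c hx0a.ge (hx0a.le.trans hab.le)]
      refine ⟨ρ, l₁, l₂, k, h1, h2, h3, h4, h5, ?_, hk1, fun x hx hxb => hk x hx (hab.le.trans hxb)⟩
      intro x hx hxb
      rcases le_total (p x).im a with h | h
      · exact h6 x hx h
      · rw [hk x hx h, hwin x hx h hxb, hkn]
    · push Not at hx
      obtain ⟨i, hi'⟩ := exp_eq_one_iff.1 hk1
      obtain ⟨j, hj⟩ := exp_eq_one_iff.1 hn1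
      -- new factor at `s`
      set s : ℂ := ⟨c, a⟩ with hs
      have hd : ∀ x, (p x).re = c → (log (-(p x - s)) - Real.pi * I - log (p x - s) =
          if a < (p x).im then -(2 * Real.pi * I) else 0) := by
        intro x hxc
        have h7 : (p x - s).im ≠ 0 := by
          intro h0
          apply hx x
          apply Complex.ext
          · simp [hs, hxc]
          · simpa [sub_eq_zero] using h0
        rw [log_jump _ (by simp [hs, hxc]) h7]
        simp [hs]
      have hslit : ∀ x, 0 ≤ (p x - s).re → p x - s ∈ slitPlane := by
        intro x h
        rcases h.lt_or_eq with h | h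
        · exact Or.inl h
        · refine Or.inr fun h' => hx x ?_
          rw [← sub_eq_zero]; exact Complex.ext h.symm h'
      have hslit' : ∀ x, (p x - s).re ≤ 0 → -(p x - s) ∈ slitPlane := by
        intro x h
        rcases h.lt_or_eq with h | h
        · exact Or.inl (by rw [neg_re]; linarith)
        · refine Or.inr fun h' => hx x ?_
          rw [← sub_eq_zero]; exact Complex.ext h (by rw [neg_im, neg_eq_zero] at h'; exact h')
      have hne : ∀ x, p x - s ≠ 0 := fun x => sub_ne_zero.2 (hx x)
      refine ⟨fun x => ρ x * (p x - s) ^ (i - j),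
        fun x => l₁ x + ((i - j : ℤ) : ℂ) * (log (-(p x - s)) - Real.pi * I),
        fun x => l₂ x + ((i - j : ℤ) : ℂ) * log (p x - s), n,
        Gen.mul ρ s (by exact ⟨rfl, hx⟩) _ h1, ?_, ?_, ?_, ?_, ?_, hn1, ?_⟩
      · refine h2.add (continuousOn_const.mul (ContinuousOn.sub (ContinuousOn.clog
          (hp.sub continuous_const).neg.continuousOn ?_) continuousOn_const))
        intro x hx'
        apply hslit'
        have : (p x).re ≤ c := hx'
        rw [sub_re]; simp [hs, this]
      · intro x hx'
        beta_reduce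
        rw [exp_add, exp_int_mul, exp_sub, exp_pi_mul_I, exp_log (neg_ne_zero.2 (hne x)), ← h3 x hx',
          neg_div_neg_eq, div_one]
      · refine h4.add (continuousOn_const.mul (ContinuousOn.clog
          (hp.sub continuous_const).continuousOn ?_))
        intro x hx'
        apply hslit
        have : c ≤ (p x).re := hx'
        rw [sub_re]; simp [hs, this]
      · intro x hx'
        beta_reduce
        rw [exp_add, exp_int_mul, exp_log (hne x), ← h5 x hx']
      · intro x hxc hxb
        have e := hd x hxc
        have e2 : l₁ x + ((i - j : ℤ) : ℂ) * (log (-(p x - s)) - Real.pi * I) -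
          (l₂ x + ((i - j : ℤ) : ℂ) * log (p x - s)) = (l₁ x - l₂ x) + ((i - j : ℤ) : ℂ) *
          (log (-(p x - s)) - Real.pi * I - log (p x - s)) := by ring
        beta_reduce
        rw [e2, e]
        split_ifs with h
        · rw [hk x hxc h.le, hwin x hxc h.le hxb, hi', hj]; push_cast; ring
        · rw [h6 x hxc (not_lt.1 h)]; ring
      · intro x hxc hxb
        have e := hd x hxc
        have e2 : l₁ x + ((i - j : ℤ) : ℂ) * (log (-(p x - s)) - Real.pi * I) -
          (l₂ x + ((i - j : ℤ) : ℂ) * log (p x - s)) = (l₁ x - l₂ x) + ((i - j : ℤ) : ℂ) *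
          (log (-(p x - s)) - Real.pi * I - log (p x - s)) := by ring
        beta_reduce
        have h : a < (p x).im := hab.trans_le hxb
        rw [e2, e, if_pos h, hk x hxc h.le, hi', hj]; push_cast; ring
  · refine ⟨fun _ => 1, 0, 0, 0, Gen.one, continuousOn_const, by simp, continuousOn_const,
      by simp, ?_, by simp, by simp⟩
    intro x _ hx
    exact absurd hx (not_le.2 (ha x))

/-- Eilenberg: every nonvanishing function is a product of an exponential and of factors `p - q`. -/
theorem eilenberg {p : X → ℂ} (hp : Continuous p) (hi : Function.Injective p)
    {F : X → ℂ} (hF : Continuous F) (h0 : ∀ x, F x ≠ 0) :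
    ∃ ρ, Gen p {q | ∀ x, p x ≠ q} ρ ∧ LogOn (fun x => F x / ρ x) univ := by
  have hre : Continuous fun x => (p x).re := continuous_re.comp hp
  obtain ⟨a, ha⟩ := exists_lower hre
  obtain ⟨b, hb⟩ := exists_upper hre
  let P : ℝ → Prop := fun c => ∃ ρ, Gen p {q | q.re < c ∧ ∀ x, p x ≠ q} ρ ∧
    LogOn (fun x => F x / ρ x) {x | (p x).re ≤ c}
  suffices hP : P (max a b) by
    obtain ⟨ρ, h1, h2⟩ := hP
    exact ⟨ρ, h1.mono fun q hq => hq.2,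
      h2.mono fun x _ => (hb x).le.trans (le_max_right a b)⟩
  refine chain P ?_ a (max a b) (le_max_left a b) ?_
  · intro c
    obtain ⟨ε, hε, hslab⟩ := slab_log hp hi hF h0 c
    refine ⟨ε, hε, fun a b ha hab hb => ?_⟩
    rintro ⟨ρ, hρ, g₁, hg₁, e₁⟩
    have hρ0 : ∀ x, ρ x ≠ 0 := hρ.ne_zero fun q hq => hq.2
    have hM : LogOn (fun x => F x / ρ x) {x | a ≤ (p x).re ∧ (p x).re ≤ b} := by
      refine LogOn.div (hslab.mono ?_) ((hρ.logOn hp (c := a) fun q hq => hq.1).mono ?_)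
      · rintro x ⟨hx1, hx2⟩
        show dist (p x).re c < ε
        rw [Real.dist_eq, abs_lt]; constructor <;> linarith
      · exact fun x hx => hx.1
    obtain ⟨g₂, hg₂, e₂⟩ := hM
    have s1 : {x | (p x).re = a} ⊆ {x | (p x).re ≤ a} := fun x hx => le_of_eq hx
    have s2 : {x | (p x).re = a} ⊆ {x | a ≤ (p x).re ∧ (p x).re ≤ b} := fun x hx => by
      have hx : (p x).re = a := hx
      exact ⟨hx.ge, hx.le.trans hab.le⟩
    obtain ⟨ρ', l₁, l₂, hρ', hl₁, f₁, hl₂, f₂, hl⟩ := step_fun hp hi a (fun x => g₁ x - g₂ x)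
      ((hg₁.mono s1).sub (hg₂.mono s2)) (fun x hx => by
        rw [exp_sub, ← e₁ x (s1 hx), ← e₂ x (s2 hx), div_self (div_ne_zero (h0 x) (hρ0 x))])
    refine ⟨fun x => ρ x * ρ' x, ?_, ?_⟩
    · refine Gen.mul' (Gen.mono ?_ hρ) (Gen.mono ?_ hρ')
      · exact fun q hq => ⟨hq.1.trans hab, hq.2⟩
      · exact fun q hq => ⟨hq.1.trans_lt hab, hq.2⟩
    · refine (glue (A := {x | (p x).re ≤ a}) (B := {x | a ≤ (p x).re ∧ (p x).re ≤ b})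
        (g₁ := fun x => g₁ x - l₁ x) (g₂ := fun x => g₂ x - l₂ x)
        (isClosed_le hre continuous_const)
        ((isClosed_le continuous_const hre).inter (isClosed_le hre continuous_const))
        (hg₁.sub hl₁) (hg₂.sub (hl₂.mono fun x hx => hx.1)) ?_ ?_ ?_).mono ?_
      · intro x hx
        rw [exp_sub, ← e₁ x hx, ← f₁ x hx, div_div]
      · intro x hx
        rw [exp_sub, ← e₂ x hx, ← f₂ x hx.1, div_div]
      · intro x hx hx'
        have := hl x (le_antisymm hx hx'.1)
        linear_combination -this
      · intro x hx
        rcases le_total (p x).re a with h | h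
        · exact Or.inl h
        · exact Or.inr ⟨h, hx⟩
  · refine ⟨fun _ => 1, Gen.one, 0, continuousOn_const, ?_⟩
    intro x hx
    exact absurd hx (not_le.2 (ha x))

/-- A nonvanishing continuous function as a unit. -/
noncomputable def mkU (F : X → ℂ) (hF : Continuous F) (h0 : ∀ x, F x ≠ 0) : C(X, ℂ)ˣ where
  val := ⟨F, hF⟩
  inv := ⟨fun x => (F x)⁻¹, hF.inv₀ h0⟩
  val_inv := by ext x; simp [h0 x]
  inv_val := by ext x; simp [h0 x]

theorem unit_ne_zero (f : C(X, ℂ)ˣ) (x : X) : (f : C(X, ℂ)) x ≠ 0 := by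
  intro h
  have := DFunLike.congr_fun f.mul_inv x
  rw [ContinuousMap.mul_apply, h] at this
  simp at this

theorem unit_inv (f : C(X, ℂ)ˣ) (x : X) :
    ((f⁻¹ : C(X, ℂ)ˣ) : C(X, ℂ)) x = ((f : C(X, ℂ)) x)⁻¹ := by
  have := DFunLike.congr_fun f.mul_inv x
  rw [ContinuousMap.mul_apply, ContinuousMap.one_apply] at this
  exact eq_inv_of_mul_eq_one_right this

/-- The subgroup of exponentials. -/
def expSub (X : Type) [TopologicalSpace X] [CompactSpace X] [T2Space X] : Subgroup C(X, ℂ)ˣ where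
  carrier := {f | LogOn (f : C(X, ℂ)) univ}
  mul_mem' := fun {a b} ha hb => (LogOn.mul ha hb).congr fun x _ => by simp
  one_mem' := (logOn_const 1 one_ne_zero).congr fun x _ => by simp
  inv_mem' := fun {a} ha => (LogOn.zpow ha (-1)).congr fun x _ => by rw [unit_inv]; simp

noncomputable instance quotComm : CommGroup (C(X, ℂ)ˣ ⧸ expSub X) :=
  { (QuotientGroup.Quotient.group (expSub X) : Group (C(X, ℂ)ˣ ⧸ expSub X)) with
    mul_comm := fun a b => by
      induction a using QuotientGroup.induction_on with | H a => ?_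
      induction b using QuotientGroup.induction_on with | H b => ?_
      rw [← QuotientGroup.mk_mul, ← QuotientGroup.mk_mul, mul_comm] }

/-- The class of a unit modulo exponentials. -/
noncomputable def cls (f : C(X, ℂ)ˣ) : Additive (C(X, ℂ)ˣ ⧸ expSub X) := Additive.ofMul (QuotientGroup.mk f)

theorem cls_eq {f g : C(X, ℂ)ˣ} (h : LogOn (fun x => (g : C(X, ℂ)) x / (f : C(X, ℂ)) x) univ) :
    cls f = cls g := by
  refine congrArg Additive.ofMul (QuotientGroup.eq.2 ?_)
  refine LogOn.congr h fun x _ => ?_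
  rw [Units.val_mul, ContinuousMap.mul_apply, unit_inv, div_eq_mul_inv, mul_comm]

theorem cls_eq_zero {f : C(X, ℂ)ˣ} : cls f = 0 ↔ LogOn (f : C(X, ℂ)) univ := by
  have : cls f = 0 ↔ f ∈ expSub X := by
    rw [← QuotientGroup.eq_one_iff]
    exact Iff.rfl
  rw [this]; exact Iff.rfl

theorem cls_mul (f g : C(X, ℂ)ˣ) : cls (f * g) = cls f + cls g := rfl
theorem cls_zpow (f : C(X, ℂ)ˣ) (m : ℤ) : cls (f ^ m) = m • cls f := rfl

theorem cls_prod {ι : Type} (s : Finset ι) (f : ι → C(X, ℂ)ˣ) :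
    cls (∏ i ∈ s, f i) = ∑ i ∈ s, cls (f i) := by
  classical
  induction s using Finset.induction_on with
  | empty => rfl
  | insert a s ha ih => rw [Finset.prod_insert ha, Finset.sum_insert ha, cls_mul, ih]

theorem unit_zpow (f : C(X, ℂ)ˣ) (m : ℤ) (x : X) :
    ((f ^ m : C(X, ℂ)ˣ) : C(X, ℂ)) x = ((f : C(X, ℂ)) x) ^ m := by
  cases m with
  | ofNat n => simp
  | negSucc n => rw [zpow_negSucc, zpow_negSucc, unit_inv]; simp

theorem card_bound {p : X → ℂ} (hp : Continuous p) (hi : Function.Injective p)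
    {ι : Type} [Fintype ι] (W : Finset ℂ)
    (hW : ∀ q, (∀ x, p x ≠ q) → LogOn (fun x => p x - q) univ ∨
      ∃ w ∈ W, (∀ x, p x ≠ w) ∧ LogOn (fun x => (p x - w) / (p x - q)) univ)
    (F : ι → X → ℂ) (hF : ∀ i, Continuous (F i)) (h0 : ∀ i x, F i x ≠ 0)
    (hind : ∀ c : ι → ℤ, LogOn (fun x => ∏ i, F i x ^ c i) univ → ∀ i, c i = 0) :
    Fintype.card ι ≤ W.card := by
  classical
  have hcont : ∀ q : ℂ, Continuous fun x => p x - q := fun q => hp.sub continuous_const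
  let z : ℂ → Additive (C(X, ℂ)ˣ ⧸ expSub X) := fun q =>
    if h : ∀ x, p x ≠ q then cls (mkU (fun x => p x - q) (hcont q) (fun x => sub_ne_zero.2 (h x)))
    else 0
  have hspan : Submodule.span ℤ (z '' (W : Set ℂ)) = ⊤ := by
    rw [eq_top_iff]
    rintro h -
    obtain ⟨f, rfl⟩ : ∃ f, cls f = h := by
      obtain ⟨f, hf⟩ := QuotientGroup.mk_surjective (Additive.toMul h)
      exact ⟨f, congrArg Additive.ofMul hf⟩
    obtain ⟨ρ, hρ, hlog⟩ := eilenberg hp hi (F := (f : C(X, ℂ))) (map_continuous _) (unit_ne_zero f)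
    have hz : ∀ q, (∀ x, p x ≠ q) → z q ∈ Submodule.span ℤ (z '' (W : Set ℂ)) := by
      intro q hq
      rcases hW q hq with h | ⟨w, hw, hw', h⟩
      · have : z q = 0 := by
          simp only [z, dif_pos hq]
          exact cls_eq_zero.2 h
        rw [this]; exact Submodule.zero_mem _
      · have : z q = z w := by
          simp only [z, dif_pos hq, dif_pos hw']
          exact cls_eq h
        rw [this]
        exact Submodule.subset_span (mem_image_of_mem _ (Finset.mem_coe.2 hw))
    have hgen : ∃ r : C(X, ℂ)ˣ, (∀ x, (r : C(X, ℂ)) x = ρ x) ∧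
        cls r ∈ Submodule.span ℤ (z '' (W : Set ℂ)) := by
      clear hlog
      induction hρ with
      | one => exact ⟨1, fun x => rfl, Submodule.zero_mem _⟩
      | mul ρ q hq m _ ih =>
        obtain ⟨r, h1, h2⟩ := ih
        have hq : ∀ x, p x ≠ q := hq
        have h3 := hz q hq
        simp only [z, dif_pos hq] at h3
        refine ⟨r * (mkU (fun x => p x - q) (hcont q) (fun x => sub_ne_zero.2 (hq x))) ^ m, ?_, ?_⟩
        · intro x
          rw [Units.val_mul, ContinuousMap.mul_apply, unit_zpow, h1]
          rfl
        · rw [cls_mul, cls_zpow]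
          exact Submodule.add_mem _ h2 (Submodule.smul_mem _ _ h3)
    obtain ⟨r, h1, h2⟩ := hgen
    have : cls r = cls f := cls_eq (hlog.congr fun x _ => by rw [h1])
    rwa [← this]
  have hli : LinearIndependent ℤ (fun i => cls (mkU (F i) (hF i) (h0 i))) := by
    rw [Fintype.linearIndependent_iff]
    intro c hc
    apply hind c
    have e : cls (∏ i, (mkU (F i) (hF i) (h0 i)) ^ c i) = 0 := by
      rw [← hc]
      exact cls_prod _ _
    refine (cls_eq_zero.1 e).congr fun x _ => ?_
    rw [Units.coe_prod, ContinuousMap.prod_apply]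
    refine Finset.prod_congr rfl fun i _ => ?_
    rw [unit_zpow]; rfl
  rw [← Finset.coe_image] at hspan
  have := linearIndependent_le_span _ hli _ hspan
  rw [Cardinal.mk_fintype] at this
  have := Nat.cast_le.1 this
  simp only [Fintype.card_coe, Finset.coe_sort_coe] at this
  exact this.trans Finset.card_image_le

theorem near_log {p : X → ℂ} (hp : Continuous p)
    (q : ℂ) (hq : ∀ x, p x ≠ q) :
    ∀ᶠ q' in 𝓝 q, LogOn (fun x => (p x - q') / (p x - q)) univ := by
  have ho : IsOpen (range p)ᶜ := (isCompact_range hp).isClosed.isOpen_compl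
  obtain ⟨δ, hδ, hb⟩ := Metric.isOpen_iff.1 ho q (by rintro ⟨x, hx⟩; exact hq x hx)
  filter_upwards [Metric.ball_mem_nhds q hδ] with q' hq'
  have hc : Continuous fun x => 1 + (q - q') / (p x - q) :=
    continuous_const.add (continuous_const.div (hp.sub continuous_const)
      (fun x => sub_ne_zero.2 (hq x)))
  refine (logOn_slit hc.continuousOn fun x _ => ?_).congr fun x _ => ?_
  · apply mem_slitPlane_of_norm_lt_one
    have h1 : δ ≤ ‖p x - q‖ := by
      by_contra h
      push Not at h
      exact hb (show p x ∈ Metric.ball q δ by rwa [Metric.mem_ball, dist_eq_norm]) (mem_range_self x)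
    have h2 : ‖q - q'‖ < δ := by rwa [← dist_eq_norm, dist_comm]
    rw [norm_div, div_lt_one (hδ.trans_le h1)]
    exact h2.trans_le h1
  · have := sub_ne_zero.2 (hq x)
    field_simp
    ring

theorem far_log {p : X → ℂ} (hp : Continuous p)
    : ∃ M : ℝ, ∀ q : ℂ, M < ‖q‖ → LogOn (fun x => p x - q) univ := by
  obtain ⟨M, hM⟩ := exists_upper hp.norm
  refine ⟨max M 0, fun q hq => ?_⟩
  have h0 : 0 < ‖q‖ := (le_max_right _ _).trans_lt hq
  have hq0 : q ≠ 0 := norm_pos_iff.1 h0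
  have hc : Continuous fun x => 1 + -(p x) / q := continuous_const.add (hp.neg.div_const _)
  refine ((logOn_const (-q) (neg_ne_zero.2 hq0)).mul
    (logOn_slit (A := univ) hc.continuousOn fun x _ => ?_)).congr fun x _ => ?_
  · apply mem_slitPlane_of_norm_lt_one
    rw [norm_div, norm_neg, div_lt_one h0]
    exact (hM x).trans ((le_max_left _ _).trans_lt hq)
  · field_simp
    ring

end

theorem small_exp {a : ℂ} (h : exp a = 1) (h1 : ‖a‖ < 1) : a = 0 := by
  obtain ⟨n, hn⟩ := exp_eq_one_iff.1 h
  have hn0 : n = 0 := by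
    by_contra hne
    have h3 : (1:ℝ) ≤ |(n:ℝ)| := by exact_mod_cast Int.one_le_abs hne
    rw [hn] at h1
    simp [abs_of_pos Real.pi_pos] at h1
    nlinarith [Real.pi_gt_three]
  simp [hn, hn0]

theorem exp_const (h : unitInterval → ℂ) (hh : Continuous h) (h1 : ∀ t, exp (h t) = 1) :
    h 0 = h 1 := by
  refine isPreconnected_univ.induction₂ (fun s t => h s = h t) ?_ ?_ ?_ (mem_univ _) (mem_univ _)
  · intro s _
    have : ∀ᶠ t in 𝓝 s, dist (h t) (h s) < 1 :=
      hh.continuousAt.eventually (Metric.ball_mem_nhds _ one_pos)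
    rw [nhdsWithin_univ]
    filter_upwards [this] with t ht
    have := small_exp (a := h t - h s) (by rw [exp_sub, h1, h1, div_one]) (by rwa [← dist_eq_norm])
    exact (sub_eq_zero.1 this).symm
  · intro x y z _ _ _ a b; exact a.trans b
  · intro x y _ _ a; exact a.symm

theorem arcs_bound {ι : Type} [Fintype ι] (γ : ι → unitInterval → ℝ × ℝ)
    (hc : ∀ i, Continuous (γ i)) (hinj : ∀ i, Function.Injective (γ i)) (u v : ℝ × ℝ) (huv : u ≠ v)
    (hγ0 : ∀ i, γ i 0 = u) (hγ1 : ∀ i, γ i 1 = v)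
    (hdis : ∀ i j, i ≠ j → ∀ s t, γ i s = γ j t → s = 0 ∨ s = 1)
    (V : Finset (ℝ × ℝ)) (hu : u ∈ V) (hv : v ∈ V)
    (hsep : ∀ x ∈ (⋃ i, range (γ i))ᶜ,
      Bornology.IsBounded (connectedComponentIn (⋃ i, range (γ i))ᶜ x) →
      ∃ y ∈ V, y ∈ connectedComponentIn (⋃ i, range (γ i))ᶜ x) :
    Fintype.card ι ≤ V.card - 1 := by
  classical
  rcases isEmpty_or_nonempty ι with hE | ⟨⟨i₀⟩⟩
  · simp
  set K : Set (ℝ × ℝ) := ⋃ i, range (γ i) with hK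
  have hKc : IsCompact K := isCompact_iUnion fun i => isCompact_range (hc i)
  have : CompactSpace K := isCompact_iff_compactSpace.1 hKc
  let φ : ℝ × ℝ → ℂ := fun x => Complex.equivRealProdCLM.symm x
  have hφ : Continuous φ := Complex.equivRealProdCLM.symm.continuous
  have hφi : Function.Injective φ := Complex.equivRealProdCLM.symm.injective
  have hφs : ∀ w, ∃ q, φ q = w := Complex.equivRealProdCLM.symm.surjective
  let p : K → ℂ := fun x => φ x.1
  have hp : Continuous p := hφ.comp continuous_subtype_val
  have hi : Function.Injective p := hφi.comp Subtype.val_injective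
  have hmem : ∀ i t, γ i t ∈ K := fun i t => mem_iUnion.2 ⟨i, mem_range_self t⟩
  let δ : (Σ _ : ι, unitInterval) → K := fun a => ⟨γ a.1 a.2, hmem a.1 a.2⟩
  have hδ : Continuous δ := Continuous.subtype_mk (continuous_sigma fun i => hc i) _
  have hδs : Function.Surjective δ := by
    rintro ⟨x, hx⟩
    obtain ⟨i, t, rfl⟩ := mem_iUnion.1 hx
    exact ⟨⟨i, t⟩, rfl⟩
  have hδq : IsQuotientMap δ := hδ.isClosedMap.isQuotientMap hδ hδs
  let F : ι → K → ℂ := fun i x =>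
    if x.1 ∈ range (γ i) then exp (2 * Real.pi * I * ((Function.invFun (γ i) x.1 : unitInterval) : ℝ))
    else 1
  have hFi : ∀ i t, F i ⟨γ i t, hmem i t⟩ = exp (2 * Real.pi * I * (t : ℝ)) := by
    intro i t
    simp only [F, if_pos (mem_range_self t)]
    rw [Function.leftInverse_invFun (hinj i) t]
  have hFj : ∀ i j t, i ≠ j → F i ⟨γ j t, hmem j t⟩ = 1 := by
    intro i j t hij
    by_cases h : γ j t ∈ range (γ i)
    · obtain ⟨s, hs⟩ := h
      have : (⟨γ j t, hmem j t⟩ : K) = ⟨γ i s, hmem i s⟩ := Subtype.ext hs.symm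
      rw [this, hFi]
      rcases hdis i j hij s t hs with rfl | rfl
      · simp
      · simp
    · simp only [F, if_neg h]
  have hF : ∀ i, Continuous (F i) := by
    intro i
    rw [hδq.continuous_iff]
    refine continuous_sigma fun j => ?_
    by_cases hij : i = j
    · subst hij
      have : (fun t => (F i ∘ δ) ⟨i, t⟩) = fun t : unitInterval => exp (2 * Real.pi * I * (t : ℝ)) :=
        funext fun t => hFi i t
      rw [this]; fun_prop
    · have : (fun t => (F i ∘ δ) ⟨j, t⟩) = fun _ => 1 := funext fun t => hFj i j t hij
      rw [this]; exact continuous_const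
  have hF0 : ∀ i x, F i x ≠ 0 := by
    intro i x
    simp only [F]
    split_ifs
    · exact exp_ne_zero _
    · exact one_ne_zero
  have hpK : ∀ q, q ∉ K → ∀ x, p x ≠ φ q := fun q hq x h => hq (hφi h ▸ x.2)
  -- constancy on components
  have hcomp : ∀ q, q ∉ K → ∀ q' ∈ connectedComponentIn Kᶜ q,
      LogOn (fun x => (p x - φ q') / (p x - φ q)) univ := by
    intro q hq q' hq'
    have hsub : connectedComponentIn Kᶜ q ⊆ Kᶜ := connectedComponentIn_subset _ _
    refine (isPreconnected_connectedComponentIn (F := Kᶜ) (x := q)).induction₂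
      (fun q q' => LogOn (fun x => (p x - φ q') / (p x - φ q)) univ) ?_ ?_ ?_
      (mem_connectedComponentIn hq) hq'
    · intro a ha
      exact nhdsWithin_le_nhds (hφ.continuousAt.eventually (near_log hp (φ a) (hpK a (hsub ha))))
    · intro a b c ha hb hc hab hbc
      refine (hab.mul hbc).congr fun x _ => ?_
      have h1 := sub_ne_zero.2 (hpK a (hsub ha) x)
      have h2 := sub_ne_zero.2 (hpK b (hsub hb) x)
      field_simp
    · intro a b ha hb hab
      refine (hab.zpow (-1)).congr fun x _ => ?_
      simp
  have hmain := card_bound hp hi (ι := {i // i ≠ i₀}) ((V.filter (· ∉ K)).image φ) ?_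
    (fun i => F i) (fun i => hF i) (fun i => hF0 i) ?_
  · have e1 : Fintype.card {i // i ≠ i₀} = Fintype.card ι - 1 := by
      rw [Fintype.card_subtype_compl, Fintype.card_subtype_eq]
    have e2 : ((V.filter (· ∉ K)).image φ).card ≤ V.card - 2 := by
      refine Finset.card_image_le.trans ?_
      have : V.filter (· ∉ K) ⊆ V \ {u, v} := by
        intro x hx
        rw [Finset.mem_filter] at hx
        rw [Finset.mem_sdiff]
        refine ⟨hx.1, fun h => hx.2 ?_⟩
        rw [Finset.mem_insert, Finset.mem_singleton] at h
        rcases h with rfl | rfl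
        · rw [← hγ0 i₀]; exact hmem _ _
        · rw [← hγ1 i₀]; exact hmem _ _
      refine (Finset.card_le_card this).trans ?_
      rw [Finset.card_sdiff_of_subset, Finset.card_pair huv]
      intro x hx
      rw [Finset.mem_insert, Finset.mem_singleton] at hx
      rcases hx with rfl | rfl <;> assumption
    have e3 : 2 ≤ V.card := by
      rw [← Finset.card_pair huv]
      apply Finset.card_le_card
      intro x hx
      rw [Finset.mem_insert, Finset.mem_singleton] at hx
      rcases hx with rfl | rfl <;> assumption
    rw [e1] at hmain
    omega
  · intro w hw
    obtain ⟨q, rfl⟩ := hφs w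
    have hq : q ∉ K := fun h => hw ⟨q, h⟩ rfl
    have hsub : connectedComponentIn Kᶜ q ⊆ Kᶜ := connectedComponentIn_subset _ _
    by_cases hb : Bornology.IsBounded (connectedComponentIn Kᶜ q)
    · right
      obtain ⟨y, hy, hy'⟩ := hsep q hq hb
      exact ⟨φ y, Finset.mem_image_of_mem _ (Finset.mem_filter.2 ⟨hy, hsub hy'⟩),
        hpK y (hsub hy'), hcomp q hq y hy'⟩
    · left
      obtain ⟨M, hM⟩ := far_log hp
      have : ∃ q' ∈ connectedComponentIn Kᶜ q, M < ‖φ q'‖ := by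
        by_contra hcon
        push Not at hcon
        apply hb
        rw [isBounded_iff_forall_norm_le]
        refine ⟨M, fun x hx => le_trans ?_ (hcon x hx)⟩
        rw [Prod.norm_def]
        exact max_le (Complex.abs_re_le_norm (φ x)) (Complex.abs_im_le_norm (φ x))
      obtain ⟨q', hq', hlt⟩ := this
      refine ((hM _ hlt).div (hcomp q hq q' hq')).congr fun x _ => ?_
      have h1 := sub_ne_zero.2 (hpK q hq x)
      have h2 := sub_ne_zero.2 (hpK q' (hsub hq') x)
      field_simp
  · rintro c ⟨g, hg, e⟩ ⟨j, hj⟩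
    have hg : Continuous g := by rwa [← continuousOn_univ]
    have hgc : ∀ i, Continuous fun t => g ⟨γ i t, hmem i t⟩ := fun i =>
      hg.comp (Continuous.subtype_mk (hc i) _)
    have hends : ∀ i, ∀ n : ℤ, (∀ t, ∏ k : {i // i ≠ i₀}, F k ⟨γ i t, hmem i t⟩ ^ c k =
        exp (2 * Real.pi * I * (t : ℝ)) ^ n) →
        g ⟨v, by rw [← hγ1 i]; exact hmem _ _⟩ - g ⟨u, by rw [← hγ0 i]; exact hmem _ _⟩ =
          n * (2 * Real.pi * I) := by
      intro i n hn
      have := exp_const (fun t => g ⟨γ i t, hmem i t⟩ - n * (2 * Real.pi * I * (t : ℝ)))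
        ((hgc i).sub (by fun_prop)) (fun t => by
          rw [exp_sub, exp_int_mul, ← hn t, ← e _ (mem_univ _)]
          exact div_self (Finset.prod_ne_zero_iff.2 fun k _ => zpow_ne_zero _ (hF0 _ _)))
      simp only [hγ0, hγ1] at this
      simp at this
      linear_combination -this
    have a0 := hends i₀ 0 (fun t => by
      rw [zpow_zero]
      refine Finset.prod_eq_one fun k _ => ?_
      rw [hFj _ _ _ k.2, one_zpow])
    have a1 := hends j (c ⟨j, hj⟩) (fun t => by
      rw [Finset.prod_eq_single ⟨j, hj⟩]
      · rw [hFi]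
      · intro k _ hk
        rw [hFj _ _ _ (fun h => hk (Subtype.ext h)), one_zpow]
      · intro h; exact (h (Finset.mem_univ _)).elim)
    rw [a0] at a1
    have h2 : (2 * Real.pi * I : ℂ) ≠ 0 := two_pi_I_ne_zero
    have h3 := mul_right_cancel₀ h2 a1
    exact_mod_cast h3.symm

end PlaneSep

theorem TopMultigraph.pair_bound (G : TopMultigraph) (hsep : G.Separated) (u v : ℝ × ℝ)
    (huv : u ≠ v) : Nat.card {e : G.ι // G.Joins e u v} ≤ G.V.card - 1 := by
  classical
  rw [Nat.card_eq_fintype_card]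
  rcases isEmpty_or_nonempty {e : G.ι // G.Joins e u v} with hE | ⟨⟨e₀, he₀⟩⟩
  · simp
  have hends : ∀ e, G.Joins e u v →
      (G.arc e 0 = u ∧ G.arc e 1 = v) ∨ (G.arc e 0 = v ∧ G.arc e 1 = u) := by
    intro e he
    have : ({G.arc e 0, G.arc e 1} : Set (ℝ × ℝ)) = {u, v} := he
    exact Set.pair_eq_pair_iff.1 this
  have hpar : ∀ e f, G.Joins e u v → G.Joins f u v → e ≠ f → ¬ G.Cross e f := by
    intro e f he hf hef
    exact hsep.1 e f ⟨hef, Eq.trans he (Eq.symm hf)⟩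
  let γ : {e : G.ι // G.Joins e u v} → unitInterval → ℝ × ℝ := fun e t =>
    if G.arc e 0 = u then G.arc e t else G.arc e (unitInterval.symm t)
  have hγ : ∀ e, γ e = G.arc e ∨ γ e = G.arc e ∘ unitInterval.symm := by
    intro e
    by_cases h : G.arc e 0 = u
    · left; funext t; simp [γ, h]
    · right; funext t; simp [γ, h]
  have hrange : ∀ e, range (γ e) = range (G.arc e) := by
    intro e
    rcases hγ e with h | h
    · rw [h]
    · rw [h]; exact unitInterval.symm_involutive.surjective.range_comp _
  have hU : G.pairUnion u v = ⋃ e, range (γ e) := by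
    simp only [TopMultigraph.pairUnion, hrange]
    ext x
    simp
  have hV : u ∈ G.V ∧ v ∈ G.V := by
    have a := G.source_mem e₀
    have b := G.target_mem e₀
    rcases hends e₀ he₀ with ⟨h1, h2⟩ | ⟨h1, h2⟩ <;> rw [h1] at a <;> rw [h2] at b
    · exact ⟨a, b⟩
    · exact ⟨b, a⟩
  have hγ0 : ∀ e, γ e 0 = u := by
    intro e
    by_cases h : G.arc e 0 = u
    · simp [γ, h]
    · rcases hends e e.2 with ⟨h1, h2⟩ | ⟨h1, h2⟩
      · exact (h h1).elim
      · simp [γ, h, h2]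
  have hγ1 : ∀ e, γ e 1 = v := by
    intro e
    by_cases h : G.arc e 0 = u
    · rcases hends e e.2 with ⟨h1, h2⟩ | ⟨h1, h2⟩
      · simp [γ, h, h2]
      · exact (huv (h.symm.trans h1)).elim
    · rcases hends e e.2 with ⟨h1, h2⟩ | ⟨h1, h2⟩
      · exact (h h1).elim
      · simp only [γ, if_neg h, unitInterval.symm_one]; exact h1
  have hinj : ∀ e, Function.Injective (γ e) := by
    intro e
    rcases hγ e with h | h
    · rw [h]; exact G.injective_arc e
    · rw [h]; exact (G.injective_arc e).comp unitInterval.symm_involutive.injective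
  have hint : ∀ (e : {e : G.ι // G.Joins e u v}) t, t ≠ 0 → t ≠ 1 → γ e t ∈ G.arcInterior e := by
    intro e t h0 h1
    rcases hγ e with h | h
    · rw [h]; exact ⟨t, ⟨h0, h1⟩, rfl⟩
    · rw [h]
      refine ⟨unitInterval.symm t, ⟨fun h => h1 ?_, fun h => h0 ?_⟩, rfl⟩
      · rw [← unitInterval.symm_symm t, h, unitInterval.symm_zero]
      · rw [← unitInterval.symm_symm t, h, unitInterval.symm_one]
  refine PlaneSep.arcs_bound γ ?_ hinj u v huv hγ0 hγ1 ?_ G.V hV.1 hV.2 ?_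
  · intro e
    rcases hγ e with h | h
    · rw [h]; exact G.continuous_arc e
    · rw [h]; exact (G.continuous_arc e).comp unitInterval.continuous_symm
  · intro e f hef s t hst
    by_contra hcon
    push Not at hcon
    have h1 := hint e s hcon.1 hcon.2
    have hVe : γ e s ∉ G.V := by
      obtain ⟨r, hr, hr'⟩ := h1
      rw [← hr']; exact G.interior_avoids e r hr.1 hr.2
    have h2 : γ f t ∈ G.arcInterior f := by
      apply hint
      · rintro rfl
        rw [hst, hγ0] at hVe; exact hVe hV.1
      · rintro rfl
        rw [hst, hγ1] at hVe; exact hVe hV.2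
    exact hpar e f e.2 f.2 (fun h => hef (Subtype.ext h)) ⟨γ e s, h1, by rw [hst]; exact h2⟩
  · rw [← hU]
    intro x hx hb
    exact hsep.2 _ ⟨u, v, huv, ⟨e₀, he₀⟩, hpar, hb, x, hx, rfl⟩

/-- In a separated topological multigraph on `n` vertices, any two distinct vertices are joined
by at most `n - 1` parallel edges; consequently `|E(G)| ≤ C(n,2)·(n-1)`. -/
theorem separated_multiplicity_bound (G : TopMultigraph) (hsep : G.Separated) :
    (∀ u v : ℝ × ℝ, u ≠ v → Nat.card {e : G.ι // G.Joins e u v} ≤ G.V.card - 1) ∧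
    G.edgeCount ≤ (G.V.card).choose 2 * (G.V.card - 1) := by
  classical
  refine ⟨G.pair_bound hsep, ?_⟩
  have h := Finset.card_le_mul_card_image_of_maps_to (s := (Finset.univ : Finset G.ι))
    (t := G.V.powersetCard 2) (f := fun e => ({G.arc e 0, G.arc e 1} : Finset (ℝ × ℝ)))
    (fun e _ => by
      rw [Finset.mem_powersetCard]
      refine ⟨?_, Finset.card_pair (G.ends_ne e)⟩
      intro x hx
      rw [Finset.mem_insert, Finset.mem_singleton] at hx
      rcases hx with rfl | rfl
      · exact G.source_mem e
      · exact G.target_mem e) (G.V.card - 1) (fun b hb => by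
      obtain ⟨u, v, huv, rfl⟩ := Finset.card_eq_two.1 (Finset.mem_powersetCard.1 hb).2
      refine le_trans (le_of_eq ?_) (G.pair_bound hsep u v huv)
      rw [Nat.card_eq_fintype_card, Fintype.card_subtype]
      congr 1
      ext e
      simp only [Finset.mem_filter, Finset.mem_univ, true_and]
      rw [← Finset.coe_inj]
      simp only [Finset.coe_insert, Finset.coe_singleton]
      exact Iff.rfl)
  rw [Finset.card_powersetCard, mul_comm] at h
  rw [TopMultigraph.edgeCount, Nat.card_eq_fintype_card]
  exact h
end

section
/- Let V be a set with n elements, let M be a nonnegative integer, and let L be a finite family of pairs ℓ = (P_ℓ, I_ℓ), where P_ℓ ⊆ V with |P_ℓ| = 2 and I_ℓ ⊆ V \ P_ℓ with |I_ℓ| ≤ M. Then for every real p with 0 < p < 1 there exists a subset W ⊆ V such that |{ℓ ∈ L : P_ℓ ⊆ W and I_ℓ ∩ W = ∅}| − 4|W| ≥ p²·(1 − p)^M·|L| − 4pn. -/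
open Finset in
open Classical in
theorem grs_weight_sum {V : Type*} [Fintype V] (A B : Finset V) (h : Disjoint B A) (p : ℝ) :
    ∑ W : Finset V, (p ^ W.card * (1 - p) ^ (Wᶜ).card) *
      (if A ⊆ W ∧ Disjoint B W then (1 : ℝ) else 0) = p ^ A.card * (1 - p) ^ B.card := by
  have key := Fintype.prod_add (fun a : V => if a ∈ B then (0 : ℝ) else p)
    (fun a : V => if a ∈ A then (0 : ℝ) else 1 - p)
  have hl : ∏ a : V, ((if a ∈ B then (0 : ℝ) else p) + (if a ∈ A then (0 : ℝ) else 1 - p))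
      = p ^ A.card * (1 - p) ^ B.card := by
    have : ∀ a : V, ((if a ∈ B then (0 : ℝ) else p) + (if a ∈ A then (0 : ℝ) else 1 - p))
        = (if a ∈ A then p else 1) * (if a ∈ B then (1 - p) else 1) := by
      intro a
      by_cases hA : a ∈ A
      · have hB : a ∉ B := fun hB => Finset.disjoint_left.1 h hB hA
        simp [hA, hB]
      · by_cases hB : a ∈ B <;> simp [hA, hB]
    simp_rw [this, Finset.prod_mul_distrib, Finset.prod_ite_mem, Finset.univ_inter,
      Finset.prod_const]
  rw [← hl, key]
  refine Finset.sum_congr rfl fun W _ => ?_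
  by_cases h1 : Disjoint B W
  · have e1 : ∏ a ∈ W, (if a ∈ B then (0 : ℝ) else p) = p ^ W.card := by
      rw [← Finset.prod_const]
      exact Finset.prod_congr rfl fun a ha => if_neg (Finset.disjoint_right.1 h1 ha)
    rw [e1]
    by_cases h2 : A ⊆ W
    · have e2 : ∏ a ∈ Wᶜ, (if a ∈ A then (0 : ℝ) else 1 - p) = (1 - p) ^ (Wᶜ).card := by
        rw [← Finset.prod_const]
        exact Finset.prod_congr rfl fun a ha =>
          if_neg fun haA => (Finset.mem_compl.1 ha) (h2 haA)
      rw [e2]; simp [h1, h2]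
    · obtain ⟨a, haA, haW⟩ := Finset.not_subset.1 h2
      have e2 : ∏ a ∈ Wᶜ, (if a ∈ A then (0 : ℝ) else 1 - p) = 0 :=
        Finset.prod_eq_zero (Finset.mem_compl.2 haW) (by simp [haA])
      rw [e2]
      simp [h2]
  · obtain ⟨a, haB, haW⟩ := Finset.not_disjoint_iff.1 h1
    have e1 : ∏ a ∈ W, (if a ∈ B then (0 : ℝ) else p) = 0 :=
      Finset.prod_eq_zero haW (by simp [haB])
    rw [e1]
    simp [h1]

/-- **Probabilistic deletion argument.** Let `V` be an `n`-element set and `L` a finite family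
of pairs `ℓ = (P_ℓ, I_ℓ)` with `P_ℓ ⊆ V`, `|P_ℓ| = 2`, `I_ℓ ⊆ V \ P_ℓ`, `|I_ℓ| ≤ M`. Then for
every `0 < p < 1` there is a subset `W ⊆ V` with
`#{ℓ : P_ℓ ⊆ W, I_ℓ ∩ W = ∅} - 4|W| ≥ p²(1-p)^M |L| - 4pn`. -/
theorem exists_good_random_subset
    {V : Type*} [Fintype V] {ι : Type*} [Fintype ι]
    (n M : ℕ) (hn : Fintype.card V = n)
    (P I : ι → Finset V)
    (hP : ∀ l, (P l).card = 2)
    (hPI : ∀ l, Disjoint (I l) (P l))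
    (hI : ∀ l, (I l).card ≤ M)
    (p : ℝ) (hp0 : 0 < p) (hp1 : p < 1) :
    ∃ W : Finset V,
      p ^ 2 * (1 - p) ^ M * (Fintype.card ι : ℝ) - 4 * p * (n : ℝ) ≤
        (Nat.card {l : ι // P l ⊆ W ∧ Disjoint (I l) W} : ℝ) - 4 * (W.card : ℝ) := by
  classical
  subst hn
  by_contra! hcon
  set w : Finset V → ℝ := fun W => p ^ W.card * (1 - p) ^ (Wᶜ).card with hw
  have hq : 0 < 1 - p := by linarith
  have hwpos : ∀ W, 0 < w W := fun W => by positivity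
  have hw1 : ∑ W, w W = 1 := by
    have := grs_weight_sum (∅ : Finset V) ∅ (by simp) p
    simpa using this
  have hcard : ∑ W : Finset V, w W * (W.card : ℝ) = p * (Fintype.card V : ℝ) := by
    have h1 : ∀ W : Finset V, w W * (W.card : ℝ)
        = ∑ v : V, w W * (if {v} ⊆ W ∧ Disjoint (∅ : Finset V) W then (1 : ℝ) else 0) := by
      intro W
      rw [← Finset.mul_sum]
      simp
    simp_rw [h1]
    rw [Finset.sum_comm]
    have h2 : ∀ v : V, ∑ W : Finset V, w W *
        (if {v} ⊆ W ∧ Disjoint (∅ : Finset V) W then (1 : ℝ) else 0) = p := by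
      intro v
      have := grs_weight_sum ({v} : Finset V) ∅ (by simp) p
      simpa using this
    rw [Finset.sum_congr rfl fun v _ => h2 v]
    simp [mul_comm]
  have hgood : p ^ 2 * (1 - p) ^ M * (Fintype.card ι : ℝ) ≤
      ∑ W : Finset V, w W * (Nat.card {l : ι // P l ⊆ W ∧ Disjoint (I l) W} : ℝ) := by
    have h1 : ∀ W : Finset V, w W * (Nat.card {l : ι // P l ⊆ W ∧ Disjoint (I l) W} : ℝ)
        = ∑ l : ι, w W * (if P l ⊆ W ∧ Disjoint (I l) W then (1 : ℝ) else 0) := by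
      intro W
      rw [← Finset.mul_sum, Nat.card_eq_fintype_card, Fintype.card_subtype, Finset.sum_boole]
    simp_rw [h1]
    rw [Finset.sum_comm]
    have h2 : ∀ l ∈ (Finset.univ : Finset ι), p ^ 2 * (1 - p) ^ M ≤ ∑ W : Finset V, w W *
        (if P l ⊆ W ∧ Disjoint (I l) W then (1 : ℝ) else 0) := by
      intro l _
      have h3 := grs_weight_sum (P l) (I l) (hPI l) p
      rw [hP l] at h3
      have h4 : p ^ 2 * (1 - p) ^ M ≤ p ^ 2 * (1 - p) ^ (I l).card :=
        mul_le_mul_of_nonneg_left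
          (pow_le_pow_of_le_one hq.le (by linarith) (hI l)) (by positivity)
      refine h4.trans (le_of_eq ?_)
      rw [← h3]
    have := Finset.sum_le_sum h2
    rw [Finset.sum_const, nsmul_eq_mul, Finset.card_univ] at this
    linarith
  have hlt : ∑ W : Finset V, w W *
        ((Nat.card {l : ι // P l ⊆ W ∧ Disjoint (I l) W} : ℝ) - 4 * (W.card : ℝ))
      < ∑ W : Finset V, w W *
        (p ^ 2 * (1 - p) ^ M * (Fintype.card ι : ℝ) - 4 * p * (Fintype.card V : ℝ)) :=
    Finset.sum_lt_sum_of_nonempty Finset.univ_nonempty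
      fun W _ => mul_lt_mul_of_pos_left (hcon W) (hwpos W)
  rw [← Finset.sum_mul, hw1] at hlt
  have hsplit : ∑ W : Finset V, w W *
        ((Nat.card {l : ι // P l ⊆ W ∧ Disjoint (I l) W} : ℝ) - 4 * (W.card : ℝ))
      = ∑ W : Finset V, w W * (Nat.card {l : ι // P l ⊆ W ∧ Disjoint (I l) W} : ℝ)
        - 4 * ∑ W : Finset V, w W * (W.card : ℝ) := by
    rw [Finset.mul_sum, ← Finset.sum_sub_distrib]
    exact Finset.sum_congr rfl fun W _ => by ring
  rw [hsplit, hcard] at hlt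
  linarith
end
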